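/- arXiv:1909.02181 — 7 statements merged into one kernel-verified Lean document; each statement's English description precedes it below -/
import Mathlib

section
/- Let k be a field, let A and B be associative unital k-algebras, and let τ : B ⊗ₖ A → A ⊗ₖ B be a bijective twisting map. Then the inverse linear map τ⁻¹ : A ⊗ₖ B → B ⊗ₖ A is a twisting map (with the roles of A and B interchanged); that is, τ⁻¹(a ⊗ 1_B) = 1_B ⊗ a and τ⁻¹(1_A ⊗ b) = b ⊗ 1_A for all a ∈ A, b ∈ B, and τ⁻¹ ∘ (m_A ⊗ m_B) = (m_B ⊗ m_A) ∘ (1_B ⊗ τ⁻¹ ⊗ 1_A) ∘ (τ⁻¹ ⊗ τ⁻¹) ∘ (1_A ⊗ τ⁻¹ ⊗ 1_B) as linear maps A ⊗ A ⊗ B ⊗ B → B ⊗ A. -/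
open TensorProduct LinearMap

noncomputable section

variable (k A B : Type*) [Field k] [Ring A] [Algebra k A] [Ring B] [Algebra k B]

/-- The right-hand side of the twisting-map (hexagon) condition:
`(m_A ⊗ m_B) ∘ (1_A ⊗ τ ⊗ 1_B) ∘ (τ ⊗ τ) ∘ (1_B ⊗ τ ⊗ 1_A)` as a linear map
`(B ⊗ B) ⊗ (A ⊗ A) → A ⊗ B`. -/
def twistRHS (τ : B ⊗[k] A →ₗ[k] A ⊗[k] B) :
    ((B ⊗[k] B) ⊗[k] (A ⊗[k] A)) →ₗ[k] (A ⊗[k] B) :=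
  map (mul' k A) (mul' k B)
    ∘ₗ (TensorProduct.assoc k A A (B ⊗[k] B)).symm.toLinearMap
    ∘ₗ lTensor A (TensorProduct.assoc k A B B).toLinearMap
    ∘ₗ lTensor A (rTensor B τ)
    ∘ₗ lTensor A (TensorProduct.assoc k B A B).symm.toLinearMap
    ∘ₗ (TensorProduct.assoc k A B (A ⊗[k] B)).toLinearMap
    ∘ₗ map τ τ
    ∘ₗ (TensorProduct.assoc k B A (B ⊗[k] A)).symm.toLinearMap
    ∘ₗ lTensor B (TensorProduct.assoc k A B A).toLinearMap
    ∘ₗ lTensor B (rTensor A τ)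
    ∘ₗ lTensor B (TensorProduct.assoc k B A A).symm.toLinearMap
    ∘ₗ (TensorProduct.assoc k B B (A ⊗[k] A)).toLinearMap

/-- `τ : B ⊗ A → A ⊗ B` is a twisting map: it is unital in each variable and
satisfies `τ ∘ (m_B ⊗ m_A) = (m_A ⊗ m_B) ∘ (1 ⊗ τ ⊗ 1) ∘ (τ ⊗ τ) ∘ (1 ⊗ τ ⊗ 1)`. -/
def IsTwistingMap (τ : B ⊗[k] A →ₗ[k] A ⊗[k] B) : Prop :=
  (∀ a : A, τ ((1 : B) ⊗ₜ[k] a) = a ⊗ₜ[k] (1 : B)) ∧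
  (∀ b : B, τ (b ⊗ₜ[k] (1 : A)) = (1 : A) ⊗ₜ[k] b) ∧
  τ ∘ₗ map (mul' k B) (mul' k A) = twistRHS k A B τ

variable {k A B} in
/-- The map `(1_A ⊗ τ ⊗ 1_B) ∘ (τ ⊗ τ) ∘ (1_B ⊗ τ ⊗ 1_A)` as a linear equivalence, for
bijective `τ`. -/
def hexagonEquiv (τ : B ⊗[k] A ≃ₗ[k] A ⊗[k] B) :
    ((B ⊗[k] B) ⊗[k] (A ⊗[k] A)) ≃ₗ[k] ((A ⊗[k] A) ⊗[k] (B ⊗[k] B)) :=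
  TensorProduct.assoc k B B (A ⊗[k] A)
    ≪≫ₗ (TensorProduct.assoc k B A A).symm.lTensor B
    ≪≫ₗ (τ.rTensor A).lTensor B
    ≪≫ₗ (TensorProduct.assoc k A B A).lTensor B
    ≪≫ₗ (TensorProduct.assoc k B A (B ⊗[k] A)).symm
    ≪≫ₗ TensorProduct.congr τ τ
    ≪≫ₗ TensorProduct.assoc k A B (A ⊗[k] B)
    ≪≫ₗ (TensorProduct.assoc k B A B).symm.lTensor A
    ≪≫ₗ (τ.rTensor B).lTensor A
    ≪≫ₗ (TensorProduct.assoc k A B B).lTensor A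
    ≪≫ₗ (TensorProduct.assoc k A A (B ⊗[k] B)).symm

theorem twistRHS_eq_comp_hexagonEquiv (τ : B ⊗[k] A ≃ₗ[k] A ⊗[k] B) :
    twistRHS k A B τ.toLinearMap =
      map (mul' k A) (mul' k B) ∘ₗ (hexagonEquiv τ).toLinearMap :=
  rfl

theorem hexagonEquiv_symm (τ : B ⊗[k] A ≃ₗ[k] A ⊗[k] B) :
    (hexagonEquiv τ).symm = hexagonEquiv τ.symm :=
  rfl

/-- If `τ : B ⊗ A → A ⊗ B` is a bijective twisting map, then the
inverse linear map `τ⁻¹ : A ⊗ B → B ⊗ A` is a twisting map with the roles of `A`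
and `B` interchanged. -/
theorem isTwistingMap_symm (τ : B ⊗[k] A ≃ₗ[k] A ⊗[k] B)
    (hτ : IsTwistingMap k A B τ.toLinearMap) :
    IsTwistingMap k B A τ.symm.toLinearMap := by
  obtain ⟨hA, hB, hmul⟩ := hτ
  refine ⟨fun b => τ.symm_apply_eq.mpr (hB b).symm, fun a => τ.symm_apply_eq.mpr (hA a).symm, ?_⟩
  rw [twistRHS_eq_comp_hexagonEquiv] at hmul ⊢
  rw [← hexagonEquiv_symm]
  refine LinearMap.ext fun x => ?_
  obtain ⟨y, rfl⟩ := (hexagonEquiv τ).surjective x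
  simpa [LinearEquiv.symm_apply_eq] using (LinearMap.congr_fun hmul y).symm

end
end

section
/- Let k be a field, let A and B be associative unital k-algebras, and let τ : B ⊗ₖ A → A ⊗ₖ B be a bijective twisting map whose inverse τ⁻¹ : A ⊗ₖ B → B ⊗ₖ A is also a twisting map. Then τ⁻¹ is an isomorphism of k-algebras from A ⊗_τ B to B ⊗_{τ⁻¹} A, where B ⊗_{τ⁻¹} A is the vector space B ⊗ₖ A with multiplication (m_B ⊗ m_A) ∘ (1_B ⊗ τ⁻¹ ⊗ 1_A). -/
open TensorProduct LinearMap

noncomputable section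

variable (k A B : Type*) [Field k] [Ring A] [Algebra k A] [Ring B] [Algebra k B]

/-- The twisted multiplication `m_τ = (m_A ⊗ m_B) ∘ (1_A ⊗ τ ⊗ 1_B)` as a linear map
`(A ⊗ B) ⊗ (A ⊗ B) → A ⊗ B`. -/
def mulTauMap (τ : B ⊗[k] A →ₗ[k] A ⊗[k] B) :
    ((A ⊗[k] B) ⊗[k] (A ⊗[k] B)) →ₗ[k] (A ⊗[k] B) :=
  map (mul' k A) (mul' k B)
    ∘ₗ (TensorProduct.assoc k A A (B ⊗[k] B)).symm.toLinearMap
    ∘ₗ lTensor A (TensorProduct.assoc k A B B).toLinearMap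
    ∘ₗ lTensor A (rTensor B τ)
    ∘ₗ lTensor A (TensorProduct.assoc k B A B).symm.toLinearMap
    ∘ₗ (TensorProduct.assoc k A B (A ⊗[k] B)).toLinearMap

/-- The twisted multiplication, curried. -/
def mulTau (τ : B ⊗[k] A →ₗ[k] A ⊗[k] B) :
    (A ⊗[k] B) →ₗ[k] (A ⊗[k] B) →ₗ[k] (A ⊗[k] B) :=
  TensorProduct.curry (mulTauMap k A B τ)

/-- Precomposing the hexagon side `twistRHS` of `τ` with `1 ⊗ τ⁻¹ ⊗ 1` cancels its innermost
factor, which turns the hexagon condition into multiplicativity of `τ`. -/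
lemma map_mulTauMap_symm (τ : B ⊗[k] A ≃ₗ[k] A ⊗[k] B)
    (h : τ.toLinearMap ∘ₗ map (mul' k B) (mul' k A) = twistRHS k A B τ.toLinearMap)
    (w : (B ⊗[k] A) ⊗[k] (B ⊗[k] A)) :
    τ (mulTauMap k B A τ.symm.toLinearMap w) =
      mulTauMap k A B τ.toLinearMap (map τ.toLinearMap τ.toLinearMap w) := by
  have hσ (x : B ⊗[k] ((A ⊗[k] B) ⊗[k] A)) :
      lTensor B (rTensor A τ.toLinearMap) (lTensor B (rTensor A τ.symm.toLinearMap) x) = x := by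
    rw [← comp_apply, ← lTensor_comp, ← rTensor_comp]
    simp
  have h₁ (x : B ⊗[k] ((B ⊗[k] A) ⊗[k] A)) :
      lTensor B (TensorProduct.assoc k B A A).symm.toLinearMap
        (lTensor B (TensorProduct.assoc k B A A).toLinearMap x) = x := by
    rw [← comp_apply, ← lTensor_comp]
    simp
  have h₂ (x : B ⊗[k] (A ⊗[k] (B ⊗[k] A))) :
      lTensor B (TensorProduct.assoc k A B A).toLinearMap
        (lTensor B (TensorProduct.assoc k A B A).symm.toLinearMap x) = x := by
    rw [← comp_apply, ← lTensor_comp]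
    simp
  simp only [mulTauMap, comp_apply, LinearEquiv.coe_coe]
  refine (LinearMap.congr_fun h _).trans ?_
  simp only [twistRHS, comp_apply, LinearEquiv.coe_coe, LinearEquiv.apply_symm_apply,
    LinearEquiv.symm_apply_apply, h₁, hσ, h₂]

/-- If `τ` is a bijective twisting map whose inverse is also a
twisting map, then `τ⁻¹` is an isomorphism of `k`-algebras from `A ⊗_τ B` to
`B ⊗_{τ⁻¹} A`: it is a bijective `k`-linear map that is multiplicative for the
twisted multiplications and preserves the unit. -/
theorem symm_algebra_iso (τ : B ⊗[k] A ≃ₗ[k] A ⊗[k] B)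
    (hτ : IsTwistingMap k A B τ.toLinearMap)
    (hτ' : IsTwistingMap k B A τ.symm.toLinearMap) :
    Function.Bijective τ.symm ∧
    (∀ x y : A ⊗[k] B,
      τ.symm (mulTau k A B τ.toLinearMap x y) =
        mulTau k B A τ.symm.toLinearMap (τ.symm x) (τ.symm y)) ∧
    τ.symm ((1 : A) ⊗ₜ[k] (1 : B)) = (1 : B) ⊗ₜ[k] (1 : A) := by
  refine ⟨τ.symm.bijective, fun x y => ?_, ?_⟩
  · rw [LinearEquiv.symm_apply_eq]
    simp only [mulTau, curry_apply]
    rw [map_mulTauMap_symm k A B τ hτ.2.2]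
    simp
  · exact hτ'.2.1 1

end
end

section
/- Let k be a field, let A and B be associative unital k-algebras, and let τ : B ⊗ₖ A → A ⊗ₖ B be a bijective twisting map. Let M be an A-bimodule compatible with τ via τ_{B,M} : B ⊗ M → M ⊗ B, and let N be a B-bimodule compatible with τ via τ_{N,A} : N ⊗ A → A ⊗ N. Then the map ρ = (ρ_A ⊗ ρ_B) ∘ (1_A ⊗ 1_M ⊗ τ ⊗ 1_N ⊗ 1_B) ∘ (1_A ⊗ τ_{B,M} ⊗ τ_{N,A} ⊗ 1_B) : (A ⊗ B) ⊗ (M ⊗ N) ⊗ (A ⊗ B) → M ⊗ N defines a unital bimodule structure on M ⊗ₖ N over the twisted tensor product algebra A ⊗_τ B; that is, the induced left and right actions are associative over A ⊗_τ B, unital, and commute with each other. -/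
open TensorProduct LinearMap

noncomputable section

variable (k A B : Type*) [Field k] [Ring A] [Algebra k A] [Ring B] [Algebra k B]

variable (M N : Type*) [AddCommGroup M] [Module k M] [AddCommGroup N] [Module k N]

/-- Compatibility of an `A`-bimodule `(M, ρM)` with the twisting map `τ`,
via `τ_{B,M} : B ⊗ M → M ⊗ B`. -/
def IsCompatibleLeft (τ : B ⊗[k] A →ₗ[k] A ⊗[k] B)
    (ρM : (A ⊗[k] (M ⊗[k] A)) →ₗ[k] M) (τBM : B ⊗[k] M →ₗ[k] M ⊗[k] B) : Prop :=
  -- `τ_{B,M} ∘ (m_B ⊗ 1_M) = (1_M ⊗ m_B) ∘ (τ_{B,M} ⊗ 1_B) ∘ (1_B ⊗ τ_{B,M})`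
  (τBM ∘ₗ rTensor M (mul' k B) ∘ₗ (TensorProduct.assoc k B B M).symm.toLinearMap =
      lTensor M (mul' k B)
        ∘ₗ (TensorProduct.assoc k M B B).toLinearMap
        ∘ₗ rTensor B τBM
        ∘ₗ (TensorProduct.assoc k B M B).symm.toLinearMap
        ∘ₗ lTensor B τBM) ∧
  -- `τ_{B,M} ∘ (1_B ⊗ ρ_A) = (ρ_A ⊗ 1_B) ∘ (1_A ⊗ 1_M ⊗ τ) ∘ (1_A ⊗ τ_{B,M} ⊗ 1_A) ∘ (τ ⊗ 1_M ⊗ 1_A)`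
  (τBM ∘ₗ lTensor B ρM =
      rTensor B ρM
        ∘ₗ (TensorProduct.assoc k A (M ⊗[k] A) B).symm.toLinearMap
        ∘ₗ lTensor A (TensorProduct.assoc k M A B).symm.toLinearMap
        ∘ₗ lTensor A (lTensor M τ)
        ∘ₗ lTensor A (TensorProduct.assoc k M B A).toLinearMap
        ∘ₗ lTensor A (rTensor A τBM)
        ∘ₗ lTensor A (TensorProduct.assoc k B M A).symm.toLinearMap
        ∘ₗ (TensorProduct.assoc k A B (M ⊗[k] A)).toLinearMap
        ∘ₗ rTensor (M ⊗[k] A) τ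
        ∘ₗ (TensorProduct.assoc k B A (M ⊗[k] A)).symm.toLinearMap)

/-- Compatibility of a `B`-bimodule `(N, ρN)` with the twisting map `τ`,
via `τ_{N,A} : N ⊗ A → A ⊗ N`. -/
def IsCompatibleRight (τ : B ⊗[k] A →ₗ[k] A ⊗[k] B)
    (ρN : (B ⊗[k] (N ⊗[k] B)) →ₗ[k] N) (τNA : N ⊗[k] A →ₗ[k] A ⊗[k] N) : Prop :=
  -- `τ_{N,A} ∘ (1_N ⊗ m_A) = (m_A ⊗ 1_N) ∘ (1_A ⊗ τ_{N,A}) ∘ (τ_{N,A} ⊗ 1_A)`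
  (τNA ∘ₗ lTensor N (mul' k A) =
      rTensor N (mul' k A)
        ∘ₗ (TensorProduct.assoc k A A N).symm.toLinearMap
        ∘ₗ lTensor A τNA
        ∘ₗ (TensorProduct.assoc k A N A).toLinearMap
        ∘ₗ rTensor A τNA
        ∘ₗ (TensorProduct.assoc k N A A).symm.toLinearMap) ∧
  -- `τ_{N,A} ∘ (ρ_B ⊗ 1_A) = (1_A ⊗ ρ_B) ∘ (τ ⊗ 1_N ⊗ 1_B) ∘ (1_B ⊗ τ_{N,A} ⊗ 1_B) ∘ (1_B ⊗ 1_N ⊗ τ)`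
  (τNA ∘ₗ rTensor A ρN =
      lTensor A ρN
        ∘ₗ (TensorProduct.assoc k A B (N ⊗[k] B)).toLinearMap
        ∘ₗ rTensor (N ⊗[k] B) τ
        ∘ₗ (TensorProduct.assoc k B A (N ⊗[k] B)).symm.toLinearMap
        ∘ₗ lTensor B (TensorProduct.assoc k A N B).toLinearMap
        ∘ₗ lTensor B (rTensor B τNA)
        ∘ₗ lTensor B (TensorProduct.assoc k N A B).symm.toLinearMap
        ∘ₗ lTensor B (lTensor N τ)
        ∘ₗ lTensor B (TensorProduct.assoc k N B A).toLinearMap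
        ∘ₗ (TensorProduct.assoc k B (N ⊗[k] B) A).toLinearMap)

/-- The map `ρ = (ρ_A ⊗ ρ_B) ∘ (1_A ⊗ 1_M ⊗ τ ⊗ 1_N ⊗ 1_B) ∘ (1_A ⊗ τ_{B,M} ⊗ τ_{N,A} ⊗ 1_B)`
from `(A ⊗ B) ⊗ (M ⊗ N) ⊗ (A ⊗ B)` to `M ⊗ N`. -/
def rhoTT (τ : B ⊗[k] A →ₗ[k] A ⊗[k] B)
    (ρM : (A ⊗[k] (M ⊗[k] A)) →ₗ[k] M) (τBM : B ⊗[k] M →ₗ[k] M ⊗[k] B)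
    (ρN : (B ⊗[k] (N ⊗[k] B)) →ₗ[k] N) (τNA : N ⊗[k] A →ₗ[k] A ⊗[k] N) :
    ((A ⊗[k] B) ⊗[k] ((M ⊗[k] N) ⊗[k] (A ⊗[k] B))) →ₗ[k] (M ⊗[k] N) :=
  rTensor N ρM
    ∘ₗ (TensorProduct.assoc k A (M ⊗[k] A) N).symm.toLinearMap
    ∘ₗ lTensor A (TensorProduct.assoc k M A N).symm.toLinearMap
    ∘ₗ lTensor A (lTensor M (lTensor A ρN))
    ∘ₗ lTensor A (lTensor M (TensorProduct.assoc k A B (N ⊗[k] B)).toLinearMap)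
    ∘ₗ lTensor A (lTensor M (rTensor (N ⊗[k] B) τ))
    ∘ₗ lTensor A (lTensor M (TensorProduct.assoc k B A (N ⊗[k] B)).symm.toLinearMap)
    ∘ₗ lTensor A (lTensor M (lTensor B (TensorProduct.assoc k A N B).toLinearMap))
    ∘ₗ lTensor A (lTensor M (lTensor B (rTensor B τNA)))
    ∘ₗ lTensor A (lTensor M (lTensor B (TensorProduct.assoc k N A B).symm.toLinearMap))
    ∘ₗ lTensor A (TensorProduct.assoc k M B (N ⊗[k] (A ⊗[k] B))).toLinearMap
    ∘ₗ lTensor A (rTensor (N ⊗[k] (A ⊗[k] B)) τBM)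
    ∘ₗ lTensor A (TensorProduct.assoc k B M (N ⊗[k] (A ⊗[k] B))).symm.toLinearMap
    ∘ₗ lTensor A (lTensor B (TensorProduct.assoc k M N (A ⊗[k] B)).toLinearMap)
    ∘ₗ (TensorProduct.assoc k A B ((M ⊗[k] N) ⊗[k] (A ⊗[k] B))).toLinearMap

section OneSidedActions

variable {k R P : Type*} [Field k] [Ring R] [Algebra k R] [AddCommGroup P] [Module k P]

/-- The left action underlying a two-sided action `R ⊗ P ⊗ R → P`. -/
def leftAct (ρ : (R ⊗[k] (P ⊗[k] R)) →ₗ[k] P) : R →ₗ[k] P →ₗ[k] P :=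
  TensorProduct.curry (ρ ∘ₗ lTensor R ((TensorProduct.mk k P R).flip 1))

/-- The right action underlying a two-sided action `R ⊗ P ⊗ R → P`. -/
def rightAct (ρ : (R ⊗[k] (P ⊗[k] R)) →ₗ[k] P) : P →ₗ[k] R →ₗ[k] P :=
  TensorProduct.curry (ρ ∘ₗ TensorProduct.mk k R (P ⊗[k] R) 1)

lemma leftAct_apply (ρ : (R ⊗[k] (P ⊗[k] R)) →ₗ[k] P) (r : R) (p : P) :
    leftAct ρ r p = ρ (r ⊗ₜ[k] (p ⊗ₜ[k] 1)) := rfl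

lemma rightAct_apply (ρ : (R ⊗[k] (P ⊗[k] R)) →ₗ[k] P) (p : P) (r : R) :
    rightAct ρ p r = ρ (1 ⊗ₜ[k] (p ⊗ₜ[k] r)) := rfl

end OneSidedActions

section Twisted

variable {k A B M N}
variable {τ : B ⊗[k] A →ₗ[k] A ⊗[k] B}
  {ρM : (A ⊗[k] (M ⊗[k] A)) →ₗ[k] M} {τBM : B ⊗[k] M →ₗ[k] M ⊗[k] B}
  {ρN : (B ⊗[k] (N ⊗[k] B)) →ₗ[k] N} {τNA : N ⊗[k] A →ₗ[k] A ⊗[k] N}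

lemma mulTau_tmul (a c : A) (b d : B) :
    mulTau k A B τ (a ⊗ₜ b) (c ⊗ₜ d) = map (mulLeft k a) (mulRight k d) (τ (b ⊗ₜ c)) := by
  simp only [mulTau, mulTauMap, curry_apply, coe_comp, LinearEquiv.coe_coe, Function.comp_apply,
    assoc_tmul, assoc_symm_tmul, lTensor_tmul, rTensor_tmul]
  induction τ (b ⊗ₜ c) with
  | zero => simp
  | add x y hx hy => simp only [add_tmul, tmul_add, map_add, hx, hy]
  | tmul c b => simp

lemma IsCompatibleLeft.mul_tmul (h : IsCompatibleLeft k A B M τ ρM τBM) (b d : B) (m : M) :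
    τBM ((b * d) ⊗ₜ m) = lTensor M (mul' k B) (TensorProduct.assoc k M B B
      (rTensor B τBM ((TensorProduct.assoc k B M B).symm (b ⊗ₜ τBM (d ⊗ₜ m))))) := by
  simpa using LinearMap.congr_fun h.1 (b ⊗ₜ (d ⊗ₜ m))

/-- Surjectivity of `τ_{B,M}` makes it unital in `B`. -/
lemma IsCompatibleLeft.one_tmul (h : IsCompatibleLeft k A B M τ ρM τBM)
    (hs : Function.Surjective τBM) (m : M) : τBM (1 ⊗ₜ m) = m ⊗ₜ 1 := by
  have key : ∀ z, lTensor M (mul' k B) (TensorProduct.assoc k M B B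
      (rTensor B τBM ((TensorProduct.assoc k B M B).symm (1 ⊗ₜ z)))) = z := fun z => by
    obtain ⟨y, rfl⟩ := hs z
    induction y with
    | zero => simp
    | add x y hx hy => simp only [tmul_add, map_add, hx, hy]
    | tmul b m => rw [← h.mul_tmul, one_mul]
  rw [← key (m ⊗ₜ 1), assoc_symm_tmul, rTensor_tmul]
  induction τBM (1 ⊗ₜ m) with
  | zero => simp
  | add x y hx hy => rw [add_tmul, map_add, map_add, ← hx, ← hy]
  | tmul m b => simp

lemma IsCompatibleLeft.tmul_leftAct (hτ : IsTwistingMap k A B τ)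
    (h : IsCompatibleLeft k A B M τ ρM τBM) (b : B) (a : A) (m : M) :
    τBM (b ⊗ₜ leftAct ρM a m) = rTensor B (lift (leftAct ρM))
      ((TensorProduct.assoc k A M B).symm (lTensor A τBM
        (TensorProduct.assoc k A B M (τ (b ⊗ₜ a) ⊗ₜ m)))) := by
  have := LinearMap.congr_fun h.2 (b ⊗ₜ (a ⊗ₜ (m ⊗ₜ 1)))
  simp only [coe_comp, LinearEquiv.coe_coe, Function.comp_apply,
    assoc_symm_tmul, lTensor_tmul, rTensor_tmul] at this
  rw [leftAct_apply, this]
  induction τ (b ⊗ₜ a) with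
  | zero => simp
  | add x y hx hy => simp only [add_tmul, map_add, hx, hy]
  | tmul a b =>
    simp only [LinearEquiv.coe_coe, assoc_tmul, assoc_symm_tmul, lTensor_tmul, rTensor_tmul]
    induction τBM (b ⊗ₜ m) with
    | zero => simp
    | add x y hx hy => simp only [add_tmul, tmul_add, map_add, hx, hy]
    | tmul m b => simp [hτ.2.1, leftAct_apply]

lemma IsCompatibleLeft.tmul_rightAct (hτ : IsTwistingMap k A B τ)
    (h : IsCompatibleLeft k A B M τ ρM τBM) (b : B) (m : M) (a : A) :
    τBM (b ⊗ₜ rightAct ρM m a) = rTensor B (lift (rightAct ρM))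
      ((TensorProduct.assoc k M A B).symm (lTensor M τ
        (TensorProduct.assoc k M B A (τBM (b ⊗ₜ m) ⊗ₜ a)))) := by
  have := LinearMap.congr_fun h.2 (b ⊗ₜ (1 ⊗ₜ (m ⊗ₜ a)))
  simp only [coe_comp, LinearEquiv.coe_coe, Function.comp_apply,
    assoc_tmul, assoc_symm_tmul, lTensor_tmul, rTensor_tmul, hτ.2.1] at this
  rw [rightAct_apply, this]
  induction τBM (b ⊗ₜ m) with
  | zero => simp
  | add x y hx hy => simp only [add_tmul, tmul_add, map_add, hx, hy]
  | tmul m b =>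
    simp only [assoc_tmul, lTensor_tmul]
    induction τ (b ⊗ₜ a) with
    | zero => simp
    | add x y hx hy => simp only [tmul_add, map_add, hx, hy]
    | tmul a b => simp [rightAct_apply]

lemma IsCompatibleRight.tmul_mul (h : IsCompatibleRight k A B N τ ρN τNA) (n : N) (a c : A) :
    τNA (n ⊗ₜ (a * c)) = rTensor N (mul' k A) ((TensorProduct.assoc k A A N).symm
      (lTensor A τNA (TensorProduct.assoc k A N A (τNA (n ⊗ₜ a) ⊗ₜ c)))) := by
  simpa using LinearMap.congr_fun h.1 (n ⊗ₜ (a ⊗ₜ c))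

/-- Surjectivity of `τ_{N,A}` makes it unital in `A`. -/
lemma IsCompatibleRight.tmul_one (h : IsCompatibleRight k A B N τ ρN τNA)
    (hs : Function.Surjective τNA) (n : N) : τNA (n ⊗ₜ 1) = 1 ⊗ₜ n := by
  have key : ∀ z, rTensor N (mul' k A) ((TensorProduct.assoc k A A N).symm
      (lTensor A τNA (TensorProduct.assoc k A N A (z ⊗ₜ 1)))) = z := fun z => by
    obtain ⟨y, rfl⟩ := hs z
    induction y with
    | zero => simp
    | add x y hx hy => simp only [add_tmul, map_add, hx, hy]
    | tmul n a => rw [← h.tmul_mul, mul_one]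
  rw [← key (1 ⊗ₜ n), assoc_tmul, lTensor_tmul]
  induction τNA (n ⊗ₜ 1) with
  | zero => simp
  | add x y hx hy => rw [tmul_add, map_add, map_add, ← hx, ← hy]
  | tmul a n => simp

lemma IsCompatibleRight.rightAct_tmul (hτ : IsTwistingMap k A B τ)
    (h : IsCompatibleRight k A B N τ ρN τNA) (n : N) (b : B) (a : A) :
    τNA (rightAct ρN n b ⊗ₜ a) = lTensor A (lift (rightAct ρN))
      (TensorProduct.assoc k A N B (rTensor B τNA
        ((TensorProduct.assoc k N A B).symm (n ⊗ₜ τ (b ⊗ₜ a))))) := by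
  have := LinearMap.congr_fun h.2 ((1 ⊗ₜ (n ⊗ₜ b)) ⊗ₜ a)
  simp only [coe_comp, LinearEquiv.coe_coe, Function.comp_apply,
    assoc_tmul, lTensor_tmul, rTensor_tmul] at this
  rw [rightAct_apply, this]
  induction τ (b ⊗ₜ a) with
  | zero => simp
  | add x y hx hy => simp only [tmul_add, map_add, hx, hy]
  | tmul a b =>
    simp only [assoc_symm_tmul, rTensor_tmul]
    induction τNA (n ⊗ₜ a) with
    | zero => simp
    | add x y hx hy => simp only [add_tmul, tmul_add, map_add, hx, hy]
    | tmul a n => simp [hτ.1, rightAct_apply]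

lemma IsCompatibleRight.leftAct_tmul (hτ : IsTwistingMap k A B τ)
    (h : IsCompatibleRight k A B N τ ρN τNA) (b : B) (n : N) (a : A) :
    τNA (leftAct ρN b n ⊗ₜ a) = lTensor A (lift (leftAct ρN))
      (TensorProduct.assoc k A B N (rTensor N τ
        ((TensorProduct.assoc k B A N).symm (b ⊗ₜ τNA (n ⊗ₜ a))))) := by
  have := LinearMap.congr_fun h.2 ((b ⊗ₜ (n ⊗ₜ 1)) ⊗ₜ a)
  simp only [coe_comp, LinearEquiv.coe_coe, Function.comp_apply,
    assoc_tmul, assoc_symm_tmul, lTensor_tmul, rTensor_tmul, hτ.1] at this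
  rw [leftAct_apply, this]
  induction τNA (n ⊗ₜ a) with
  | zero => simp
  | add x y hx hy => simp only [add_tmul, tmul_add, map_add, hx, hy]
  | tmul a n =>
    simp only [assoc_tmul, assoc_symm_tmul, rTensor_tmul]
    induction τ (b ⊗ₜ a) with
    | zero => simp
    | add x y hx hy => simp only [add_tmul, map_add, hx, hy]
    | tmul a b => simp [leftAct_apply]

/-- The left action on pure tensors: `(a ⊗ b) • (m ⊗ n) = a m' ⊗ b' n`, `m' ⊗ b' = τ_{B,M}(b ⊗ m)`. -/
lemma rhoTT_tmul_one (hτ : IsTwistingMap k A B τ) (hN : ∀ n : N, τNA (n ⊗ₜ 1) = 1 ⊗ₜ n)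
    (a : A) (b : B) (m : M) (n : N) :
    rhoTT k A B M N τ ρM τBM ρN τNA ((a ⊗ₜ b) ⊗ₜ ((m ⊗ₜ n) ⊗ₜ (1 ⊗ₜ 1))) =
      map (leftAct ρM a) ((leftAct ρN).flip n) (τBM (b ⊗ₜ m)) := by
  simp only [rhoTT, coe_comp, LinearEquiv.coe_coe, Function.comp_apply,
    assoc_tmul, assoc_symm_tmul, lTensor_tmul, rTensor_tmul]
  induction τBM (b ⊗ₜ m) with
  | zero => simp
  | add x y hx hy => simp only [add_tmul, tmul_add, map_add, hx, hy]
  | tmul m b => simp [hN, hτ.2.1, leftAct_apply]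

/-- The right action on pure tensors: `(m ⊗ n) • (a ⊗ b) = m a' ⊗ n' b`, `a' ⊗ n' = τ_{N,A}(n ⊗ a)`. -/
lemma rhoTT_one_tmul (hτ : IsTwistingMap k A B τ) (hM : ∀ m : M, τBM (1 ⊗ₜ m) = m ⊗ₜ 1)
    (a : A) (b : B) (m : M) (n : N) :
    rhoTT k A B M N τ ρM τBM ρN τNA ((1 ⊗ₜ 1) ⊗ₜ ((m ⊗ₜ n) ⊗ₜ (a ⊗ₜ b))) =
      map (rightAct ρM m) ((rightAct ρN).flip b) (τNA (n ⊗ₜ a)) := by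
  simp only [rhoTT, coe_comp, LinearEquiv.coe_coe, Function.comp_apply,
    assoc_tmul, assoc_symm_tmul, lTensor_tmul, rTensor_tmul, hM]
  induction τNA (n ⊗ₜ a) with
  | zero => simp
  | add x y hx hy => simp only [add_tmul, tmul_add, map_add, hx, hy]
  | tmul a n => simp [hτ.1, rightAct_apply]


/-- Associativity of the left action of `A ⊗_τ B` on pure tensors. -/
lemma rhoTT_mulTau_left (hτ : IsTwistingMap k A B τ)
    (hN : ∀ n : N, τNA (n ⊗ₜ 1) = 1 ⊗ₜ n) (hcM : IsCompatibleLeft k A B M τ ρM τBM)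
    (hM2 : ∀ a c m, leftAct ρM a (leftAct ρM c m) = leftAct ρM (a * c) m)
    (hN2 : ∀ b d n, leftAct ρN b (leftAct ρN d n) = leftAct ρN (b * d) n)
    (a c : A) (b d : B) (m : M) (n : N) :
    rhoTT k A B M N τ ρM τBM ρN τNA
        (mulTau k A B τ (a ⊗ₜ b) (c ⊗ₜ d) ⊗ₜ ((m ⊗ₜ n) ⊗ₜ (1 ⊗ₜ 1))) =
      rhoTT k A B M N τ ρM τBM ρN τNA ((a ⊗ₜ b) ⊗ₜ
        (rhoTT k A B M N τ ρM τBM ρN τNA ((c ⊗ₜ d) ⊗ₜ ((m ⊗ₜ n) ⊗ₜ (1 ⊗ₜ 1))) ⊗ₜ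
          (1 ⊗ₜ 1))) := by
  rw [mulTau_tmul, rhoTT_tmul_one hτ hN c d m n]
  trans map (lift (leftAct ρM)) ((leftAct ρN).flip n) ((TensorProduct.assoc k A M B).symm
    (map (mulLeft k a) (lTensor M (mul' k B) ∘ₗ (TensorProduct.assoc k M B B).toLinearMap ∘ₗ
      rTensor B τBM ∘ₗ (TensorProduct.assoc k B M B).symm.toLinearMap)
      (TensorProduct.assoc k A B (M ⊗[k] B) (τ (b ⊗ₜ c) ⊗ₜ τBM (d ⊗ₜ m)))))
  · induction τ (b ⊗ₜ c) with
    | zero => simp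
    | add x y hx hy => simp only [add_tmul, map_add, hx, hy]
    | tmul c b =>
      simp only [map_tmul, mulLeft_apply, mulRight_apply, rhoTT_tmul_one hτ hN, hcM.mul_tmul,
        assoc_tmul, coe_comp, LinearEquiv.coe_coe, Function.comp_apply]
      generalize lTensor M (mul' k B) _ = z
      induction z with
      | zero => simp
      | add x y hx hy => simp only [tmul_add, map_add, hx, hy]
      | tmul m b => simp
  · induction τBM (d ⊗ₜ m) with
    | zero => simp
    | add x y hx hy => simp only [add_tmul, tmul_add, map_add, hx, hy]
    | tmul m d =>
      rw [map_tmul, rhoTT_tmul_one hτ hN, hcM.tmul_leftAct hτ]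
      induction τ (b ⊗ₜ c) with
      | zero => simp
      | add x y hx hy => simp only [add_tmul, map_add, hx, hy]
      | tmul c b =>
        simp only [map_tmul, assoc_tmul, assoc_symm_tmul, lTensor_tmul, rTensor_tmul, coe_comp,
          LinearEquiv.coe_coe, Function.comp_apply]
        induction τBM (b ⊗ₜ m) with
        | zero => simp
        | add x y hx hy => simp only [add_tmul, tmul_add, map_add, hx, hy]
        | tmul m b => simp [hM2, hN2]

/-- Associativity of the right action of `A ⊗_τ B` on pure tensors. -/
lemma rhoTT_mulTau_right (hτ : IsTwistingMap k A B τ)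
    (hM : ∀ m : M, τBM (1 ⊗ₜ m) = m ⊗ₜ 1) (hcN : IsCompatibleRight k A B N τ ρN τNA)
    (hM2 : ∀ m a c, rightAct ρM (rightAct ρM m a) c = rightAct ρM m (a * c))
    (hN2 : ∀ n b d, rightAct ρN (rightAct ρN n b) d = rightAct ρN n (b * d))
    (a c : A) (b d : B) (m : M) (n : N) :
    rhoTT k A B M N τ ρM τBM ρN τNA
        ((1 ⊗ₜ 1) ⊗ₜ ((m ⊗ₜ n) ⊗ₜ mulTau k A B τ (a ⊗ₜ b) (c ⊗ₜ d))) =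
      rhoTT k A B M N τ ρM τBM ρN τNA ((1 ⊗ₜ 1) ⊗ₜ
        (rhoTT k A B M N τ ρM τBM ρN τNA ((1 ⊗ₜ 1) ⊗ₜ ((m ⊗ₜ n) ⊗ₜ (a ⊗ₜ b))) ⊗ₜ
          (c ⊗ₜ d))) := by
  rw [mulTau_tmul, rhoTT_one_tmul hτ hM a b m n]
  trans map (rightAct ρM m) (lift (rightAct ρN)) (TensorProduct.assoc k A N B
    (map (rTensor N (mul' k A) ∘ₗ (TensorProduct.assoc k A A N).symm.toLinearMap ∘ₗ
      lTensor A τNA ∘ₗ (TensorProduct.assoc k A N A).toLinearMap) (mulRight k d)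
      ((TensorProduct.assoc k (A ⊗[k] N) A B).symm (τNA (n ⊗ₜ a) ⊗ₜ τ (b ⊗ₜ c)))))
  · induction τ (b ⊗ₜ c) with
    | zero => simp
    | add x y hx hy => simp only [tmul_add, map_add, hx, hy]
    | tmul c b =>
      simp only [map_tmul, mulLeft_apply, mulRight_apply, rhoTT_one_tmul hτ hM, hcN.tmul_mul,
        assoc_symm_tmul, coe_comp, LinearEquiv.coe_coe, Function.comp_apply]
      generalize rTensor N (mul' k A) _ = z
      induction z with
      | zero => simp
      | add x y hx hy => simp only [add_tmul, map_add, hx, hy]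
      | tmul a n => simp
  · induction τNA (n ⊗ₜ a) with
    | zero => simp
    | add x y hx hy => simp only [add_tmul, tmul_add, map_add, hx, hy]
    | tmul a n =>
      rw [map_tmul, flip_apply, rhoTT_one_tmul hτ hM, hcN.rightAct_tmul hτ]
      induction τ (b ⊗ₜ c) with
      | zero => simp
      | add x y hx hy => simp only [tmul_add, map_add, hx, hy]
      | tmul c b =>
        simp only [map_tmul, assoc_tmul, assoc_symm_tmul, lTensor_tmul, rTensor_tmul, coe_comp,
          LinearEquiv.coe_coe, Function.comp_apply]
        induction τNA (n ⊗ₜ c) with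
        | zero => simp
        | add x y hx hy => simp only [add_tmul, tmul_add, map_add, hx, hy]
        | tmul c n => simp [hM2, hN2]

/-- The map `1_M ⊗ τ ⊗ 1_N`, landing in `(M ⊗ A) ⊗ (B ⊗ N)`. -/
def middleTwist (τ : B ⊗[k] A →ₗ[k] A ⊗[k] B) :
    ((M ⊗[k] B) ⊗[k] (A ⊗[k] N)) →ₗ[k] ((M ⊗[k] A) ⊗[k] (B ⊗[k] N)) :=
  (TensorProduct.assoc k M A (B ⊗[k] N)).symm.toLinearMap
    ∘ₗ lTensor M ((TensorProduct.assoc k A B N).toLinearMap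
      ∘ₗ rTensor N τ
      ∘ₗ (TensorProduct.assoc k B A N).symm.toLinearMap)
    ∘ₗ (TensorProduct.assoc k M B (A ⊗[k] N)).toLinearMap

lemma middleTwist_tmul (m : M) (b : B) (a : A) (n : N) :
    middleTwist τ ((m ⊗ₜ[k] b) ⊗ₜ[k] (a ⊗ₜ[k] n)) =
      map (TensorProduct.mk k M A m) ((TensorProduct.mk k B N).flip n) (τ (b ⊗ₜ a)) := by
  simp only [middleTwist, coe_comp, LinearEquiv.coe_coe, Function.comp_apply,
    assoc_tmul, assoc_symm_tmul, lTensor_tmul, rTensor_tmul]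
  induction τ (b ⊗ₜ a) with
  | zero => simp
  | add x y hx hy => simp only [add_tmul, tmul_add, map_add, hx, hy]
  | tmul a b => simp

/-- The two-sided action on pure tensors in terms of one-sided actions. -/
lemma rhoTT_tmul (hM : ∀ a m c, leftAct ρM a (rightAct ρM m c) = ρM (a ⊗ₜ (m ⊗ₜ c)))
    (hN : ∀ b n d, rightAct ρN (leftAct ρN b n) d = ρN (b ⊗ₜ (n ⊗ₜ d)))
    (a c : A) (b d : B) (m : M) (n : N) :
    rhoTT k A B M N τ ρM τBM ρN τNA ((a ⊗ₜ b) ⊗ₜ ((m ⊗ₜ n) ⊗ₜ (c ⊗ₜ d))) =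
      map (leftAct ρM a ∘ₗ lift (rightAct ρM)) ((rightAct ρN).flip d ∘ₗ lift (leftAct ρN))
        (middleTwist τ (τBM (b ⊗ₜ m) ⊗ₜ τNA (n ⊗ₜ c))) := by
  simp only [rhoTT, coe_comp, LinearEquiv.coe_coe, Function.comp_apply,
    assoc_tmul, assoc_symm_tmul, lTensor_tmul, rTensor_tmul]
  induction τBM (b ⊗ₜ m) with
  | zero => simp
  | add x y hx hy => simp only [add_tmul, tmul_add, map_add, hx, hy]
  | tmul m b =>
    simp only [LinearEquiv.coe_coe, assoc_tmul, assoc_symm_tmul, lTensor_tmul, rTensor_tmul]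
    induction τNA (n ⊗ₜ c) with
    | zero => simp
    | add x y hx hy => simp only [add_tmul, tmul_add, map_add, hx, hy]
    | tmul c n =>
      simp only [assoc_tmul, assoc_symm_tmul, rTensor_tmul, middleTwist_tmul]
      induction τ (b ⊗ₜ c) with
      | zero => simp
      | add x y hx hy => simp only [add_tmul, tmul_add, map_add, hx, hy]
      | tmul c b => simp [hM, hN]

/-- Acting on the right, then on the left, is the two-sided action. -/
lemma rhoTT_left_right (hτ : IsTwistingMap k A B τ)
    (hM1 : ∀ m : M, τBM (1 ⊗ₜ m) = m ⊗ₜ 1) (hN1 : ∀ n : N, τNA (n ⊗ₜ 1) = 1 ⊗ₜ n)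
    (hcM : IsCompatibleLeft k A B M τ ρM τBM)
    (hM : ∀ a m c, leftAct ρM a (rightAct ρM m c) = ρM (a ⊗ₜ (m ⊗ₜ c)))
    (hN : ∀ b n d, rightAct ρN (leftAct ρN b n) d = ρN (b ⊗ₜ (n ⊗ₜ d)))
    (hN' : ∀ b n d, leftAct ρN b (rightAct ρN n d) = ρN (b ⊗ₜ (n ⊗ₜ d)))
    (a c : A) (b d : B) (m : M) (n : N) :
    rhoTT k A B M N τ ρM τBM ρN τNA ((a ⊗ₜ b) ⊗ₜ
        (rhoTT k A B M N τ ρM τBM ρN τNA ((1 ⊗ₜ 1) ⊗ₜ ((m ⊗ₜ n) ⊗ₜ (c ⊗ₜ d))) ⊗ₜ (1 ⊗ₜ 1))) =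
      rhoTT k A B M N τ ρM τBM ρN τNA ((a ⊗ₜ b) ⊗ₜ ((m ⊗ₜ n) ⊗ₜ (c ⊗ₜ d))) := by
  rw [rhoTT_one_tmul hτ hM1, rhoTT_tmul hM hN]
  induction τNA (n ⊗ₜ c) with
  | zero => simp
  | add x y hx hy => simp only [add_tmul, tmul_add, map_add, hx, hy]
  | tmul c n =>
    rw [map_tmul, rhoTT_tmul_one hτ hN1, hcM.tmul_rightAct hτ]
    induction τBM (b ⊗ₜ m) with
    | zero => simp
    | add x y hx hy => simp only [add_tmul, map_add, hx, hy]
    | tmul m b =>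
      simp only [assoc_tmul, lTensor_tmul, middleTwist_tmul]
      induction τ (b ⊗ₜ c) with
      | zero => simp
      | add x y hx hy => simp only [tmul_add, map_add, hx, hy]
      | tmul c b => simp [hM, hN, hN']

/-- Acting on the left, then on the right, is the two-sided action. -/
lemma rhoTT_right_left (hτ : IsTwistingMap k A B τ)
    (hM1 : ∀ m : M, τBM (1 ⊗ₜ m) = m ⊗ₜ 1) (hN1 : ∀ n : N, τNA (n ⊗ₜ 1) = 1 ⊗ₜ n)
    (hcN : IsCompatibleRight k A B N τ ρN τNA)
    (hM : ∀ a m c, leftAct ρM a (rightAct ρM m c) = ρM (a ⊗ₜ (m ⊗ₜ c)))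
    (hM' : ∀ a m c, rightAct ρM (leftAct ρM a m) c = ρM (a ⊗ₜ (m ⊗ₜ c)))
    (hN : ∀ b n d, rightAct ρN (leftAct ρN b n) d = ρN (b ⊗ₜ (n ⊗ₜ d)))
    (a c : A) (b d : B) (m : M) (n : N) :
    rhoTT k A B M N τ ρM τBM ρN τNA ((1 ⊗ₜ 1) ⊗ₜ
        (rhoTT k A B M N τ ρM τBM ρN τNA ((a ⊗ₜ b) ⊗ₜ ((m ⊗ₜ n) ⊗ₜ (1 ⊗ₜ 1))) ⊗ₜ (c ⊗ₜ d))) =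
      rhoTT k A B M N τ ρM τBM ρN τNA ((a ⊗ₜ b) ⊗ₜ ((m ⊗ₜ n) ⊗ₜ (c ⊗ₜ d))) := by
  rw [rhoTT_tmul_one hτ hN1, rhoTT_tmul hM hN]
  induction τBM (b ⊗ₜ m) with
  | zero => simp
  | add x y hx hy => simp only [add_tmul, tmul_add, map_add, hx, hy]
  | tmul m b =>
    rw [map_tmul, flip_apply, rhoTT_one_tmul hτ hM1, hcN.leftAct_tmul hτ]
    induction τNA (n ⊗ₜ c) with
    | zero => simp
    | add x y hx hy => simp only [tmul_add, map_add, hx, hy]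
    | tmul c n =>
      simp only [assoc_symm_tmul, rTensor_tmul, middleTwist_tmul]
      induction τ (b ⊗ₜ c) with
      | zero => simp
      | add x y hx hy => simp only [add_tmul, map_add, hx, hy]
      | tmul c b => simp [hM, hM', hN]

end Twisted

/-- If `M` is an `A`-bimodule compatible with a bijective twisting map `τ`
via `τ_{B,M}`, and `N` is a `B`-bimodule compatible with `τ` via `τ_{N,A}`, then
`ρ = (ρ_A ⊗ ρ_B) ∘ (1 ⊗ 1 ⊗ τ ⊗ 1 ⊗ 1) ∘ (1 ⊗ τ_{B,M} ⊗ τ_{N,A} ⊗ 1)` defines a unital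
`A ⊗_τ B`-bimodule structure on `M ⊗ N`: the induced left and right actions are
associative over `A ⊗_τ B`, unital, and commute with each other. -/
theorem rhoTT_bimodule (τ : B ⊗[k] A ≃ₗ[k] A ⊗[k] B)
    (hτ : IsTwistingMap k A B τ.toLinearMap)
    (ρM : (A ⊗[k] (M ⊗[k] A)) →ₗ[k] M) (τBM : B ⊗[k] M ≃ₗ[k] M ⊗[k] B)
    (ρN : (B ⊗[k] (N ⊗[k] B)) →ₗ[k] N) (τNA : N ⊗[k] A ≃ₗ[k] A ⊗[k] N)
    -- `M` is a unital `A`-bimodule: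
    (hM1 : ∀ m : M, ρM ((1 : A) ⊗ₜ[k] (m ⊗ₜ[k] (1 : A))) = m)
    (hM2 : ∀ (a c a' c' : A) (m : M),
      ρM (a ⊗ₜ[k] ((ρM (c ⊗ₜ[k] (m ⊗ₜ[k] c'))) ⊗ₜ[k] a')) =
        ρM ((a * c) ⊗ₜ[k] (m ⊗ₜ[k] (c' * a'))))
    -- `N` is a unital `B`-bimodule:
    (hN1 : ∀ n : N, ρN ((1 : B) ⊗ₜ[k] (n ⊗ₜ[k] (1 : B))) = n)
    (hN2 : ∀ (b d b' d' : B) (n : N),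
      ρN (b ⊗ₜ[k] ((ρN (d ⊗ₜ[k] (n ⊗ₜ[k] d'))) ⊗ₜ[k] b')) =
        ρN ((b * d) ⊗ₜ[k] (n ⊗ₜ[k] (d' * b'))))
    -- compatibility with `τ`:
    (hcM : IsCompatibleLeft k A B M τ.toLinearMap ρM τBM.toLinearMap)
    (hcN : IsCompatibleRight k A B N τ.toLinearMap ρN τNA.toLinearMap) :
    -- the conclusion, for `ρ`, `m_τ`, and the unit `1 = 1_A ⊗ 1_B`:
    letI ρ := rhoTT k A B M N τ.toLinearMap ρM τBM.toLinearMap ρN τNA.toLinearMap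
    letI mul := mulTau k A B τ.toLinearMap
    letI one := (1 : A) ⊗ₜ[k] (1 : B)
    letI L := fun (x : A ⊗[k] B) (u : M ⊗[k] N) => ρ (x ⊗ₜ[k] (u ⊗ₜ[k] one))
    letI R := fun (u : M ⊗[k] N) (x : A ⊗[k] B) => ρ (one ⊗ₜ[k] (u ⊗ₜ[k] x))
    -- the left action is associative and unital
    (∀ (x y : A ⊗[k] B) (u : M ⊗[k] N), L (mul x y) u = L x (L y u)) ∧
    (∀ u : M ⊗[k] N, L one u = u) ∧
    -- the right action is associative and unital
    (∀ (x y : A ⊗[k] B) (u : M ⊗[k] N), R u (mul x y) = R (R u x) y) ∧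
    (∀ u : M ⊗[k] N, R u one = u) ∧
    -- the two actions commute
    (∀ (x y : A ⊗[k] B) (u : M ⊗[k] N), L x (R u y) = R (L x u) y) ∧
    -- and `ρ` is the resulting two-sided action
    (∀ (x y : A ⊗[k] B) (u : M ⊗[k] N), ρ (x ⊗ₜ[k] (u ⊗ₜ[k] y)) = L x (R u y)) := by
  have hτBM : ∀ m : M, τBM.toLinearMap (1 ⊗ₜ m) = m ⊗ₜ 1 := hcM.one_tmul τBM.surjective
  have hτNA : ∀ n : N, τNA.toLinearMap (n ⊗ₜ 1) = 1 ⊗ₜ n := hcN.tmul_one τNA.surjective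
  have hMlr : ∀ a m c, leftAct ρM a (rightAct ρM m c) = ρM (a ⊗ₜ (m ⊗ₜ c)) := by
    simp [leftAct_apply, rightAct_apply, hM2]
  have hMrl : ∀ a m c, rightAct ρM (leftAct ρM a m) c = ρM (a ⊗ₜ (m ⊗ₜ c)) := by
    simp [leftAct_apply, rightAct_apply, hM2]
  have hNlr : ∀ b n d, leftAct ρN b (rightAct ρN n d) = ρN (b ⊗ₜ (n ⊗ₜ d)) := by
    simp [leftAct_apply, rightAct_apply, hN2]
  have hNrl : ∀ b n d, rightAct ρN (leftAct ρN b n) d = ρN (b ⊗ₜ (n ⊗ₜ d)) := by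
    simp [leftAct_apply, rightAct_apply, hN2]
  have left_right := rhoTT_left_right hτ hτBM hτNA hcM hMlr hNrl hNlr
  have right_left := rhoTT_right_left hτ hτBM hτNA hcN hMlr hMrl hNrl
  have unital : ∀ u : M ⊗[k] N, rhoTT k A B M N τ.toLinearMap ρM τBM.toLinearMap ρN
      τNA.toLinearMap ((1 ⊗ₜ 1) ⊗ₜ (u ⊗ₜ (1 ⊗ₜ 1))) = u := fun u => by
    induction u with
    | zero => simp
    | add u v hu hv => simp only [add_tmul, tmul_add, map_add, hu, hv]
    | tmul m n => simp [rhoTT_tmul_one hτ hτNA, hτBM, leftAct_apply, hM1, hN1, -LinearEquiv.coe_coe]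
  refine ⟨fun x y u => ?_, unital, fun x y u => ?_, unital, fun x y u => ?_, fun x y u => ?_⟩
  · induction x with
    | zero => simp
    | add x x' hx hx' => simp only [add_tmul, map_add, LinearMap.add_apply, hx, hx']
    | tmul a b =>
      induction y with
      | zero => simp
      | add y y' hy hy' => simp only [add_tmul, tmul_add, map_add, hy, hy']
      | tmul c d =>
        induction u with
        | zero => simp
        | add u v hu hv => simp only [add_tmul, tmul_add, map_add, hu, hv]
        | tmul m n =>
          exact rhoTT_mulTau_left hτ hτNA hcM (by simp [leftAct_apply, hM2])
            (by simp [leftAct_apply, hN2]) a c b d m n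
  · induction x with
    | zero => simp
    | add x x' hx hx' => simp only [add_tmul, tmul_add, map_add, LinearMap.add_apply, hx, hx']
    | tmul a b =>
      induction y with
      | zero => simp
      | add y y' hy hy' => simp only [tmul_add, map_add, hy, hy']
      | tmul c d =>
        induction u with
        | zero => simp
        | add u v hu hv => simp only [add_tmul, tmul_add, map_add, hu, hv]
        | tmul m n =>
          exact rhoTT_mulTau_right hτ hτBM hcN (by simp [rightAct_apply, hM2])
            (by simp [rightAct_apply, hN2]) a c b d m n
  · induction x with
    | zero => simp
    | add x x' hx hx' => simp only [add_tmul, tmul_add, map_add, hx, hx']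
    | tmul a b =>
      induction y with
      | zero => simp
      | add y y' hy hy' => simp only [add_tmul, tmul_add, map_add, hy, hy']
      | tmul c d =>
        induction u with
        | zero => simp
        | add u v hu hv => simp only [add_tmul, tmul_add, map_add, hu, hv]
        | tmul m n =>
          exact (left_right a c b d m n).trans (right_left a c b d m n).symm
  · induction x with
    | zero => simp
    | add x x' hx hx' => simp only [add_tmul, map_add, hx, hx']
    | tmul a b =>
      induction y with
      | zero => simp
      | add y y' hy hy' => simp only [add_tmul, tmul_add, map_add, hy, hy']
      | tmul c d =>
        induction u with
        | zero => simp
        | add u v hu hv => simp only [add_tmul, tmul_add, map_add, hu, hv]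
        | tmul m n =>
          exact (left_right a c b d m n).symm

end
end

section
/- Let k be a field, let A = k[x] and B = k[y] be polynomial algebras in one variable. There exists a unique twisting map τ : B ⊗ₖ A → A ⊗ₖ B with τ(y ⊗ x) = x ⊗ y + x² ⊗ 1. Moreover τ is bijective, and its inverse τ⁻¹ : A ⊗ₖ B → B ⊗ₖ A is the unique twisting map (with the roles of A and B interchanged) satisfying τ⁻¹(x ⊗ y) = y ⊗ x − 1 ⊗ x². -/
open TensorProduct LinearMap

noncomputable section

variable (k A B : Type*) [Field k] [Ring A] [Algebra k A] [Ring B] [Algebra k B]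

namespace TwistingMap

section General

variable {F C D : Type*} [Field F] [Ring C] [Algebra F C] [Ring D] [Algebra F D]

/-- The multiplication `(m_C ⊗ m_D) ∘ (1_C ⊗ τ ⊗ 1_D)` on `C ⊗ D` induced by `τ`. -/
def twistMul (τ : D ⊗[F] C →ₗ[F] C ⊗[F] D) :
    (C ⊗[F] D) ⊗[F] (C ⊗[F] D) →ₗ[F] C ⊗[F] D :=
  map (mul' F C) (mul' F D)
    ∘ₗ (TensorProduct.assoc F C C (D ⊗[F] D)).symm.toLinearMap
    ∘ₗ lTensor C (TensorProduct.assoc F C D D).toLinearMap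
    ∘ₗ lTensor C (rTensor D τ)
    ∘ₗ lTensor C (TensorProduct.assoc F D C D).symm.toLinearMap
    ∘ₗ (TensorProduct.assoc F C D (C ⊗[F] D)).toLinearMap

theorem twistMul_tmul (τ : D ⊗[F] C →ₗ[F] C ⊗[F] D) (p r : C) (q t : D) :
    twistMul τ ((p ⊗ₜ q) ⊗ₜ (r ⊗ₜ t)) =
      map (LinearMap.mulLeft F p) (LinearMap.mulRight F t) (τ (q ⊗ₜ r)) := by
  simp only [twistMul, LinearMap.comp_apply, LinearEquiv.coe_coe, TensorProduct.assoc_tmul,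
    TensorProduct.assoc_symm_tmul, LinearMap.lTensor_tmul, LinearMap.rTensor_tmul]
  induction τ (q ⊗ₜ r) with
  | zero => simp
  | add u v hu hv => simp only [TensorProduct.add_tmul, TensorProduct.tmul_add, map_add, hu, hv]
  | tmul c d => simp

/-- The linear map `c ⊗ d ↦ τ (b ⊗ c) * τ (d ⊗ a')`, the product being `twistMul τ`. -/
def twistTail (τ : D ⊗[F] C →ₗ[F] C ⊗[F] D) (b : D) (a' : C) :
    C ⊗[F] D →ₗ[F] C ⊗[F] D :=
  twistMul τ ∘ₗ map (τ ∘ₗ TensorProduct.mk F D C b) (τ ∘ₗ (TensorProduct.mk F D C).flip a')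

theorem twistTail_tmul (τ : D ⊗[F] C →ₗ[F] C ⊗[F] D) (b d : D) (a' c : C) :
    twistTail τ b a' (c ⊗ₜ d) = twistMul τ (τ (b ⊗ₜ c) ⊗ₜ τ (d ⊗ₜ a')) := rfl

theorem twistRHS_tmul (τ : D ⊗[F] C →ₗ[F] C ⊗[F] D) (b b' : D) (a a' : C) :
    twistRHS F C D τ ((b ⊗ₜ b') ⊗ₜ (a ⊗ₜ a')) = twistTail τ b a' (τ (b' ⊗ₜ a)) := by
  have : twistRHS F C D τ = twistMul τ
    ∘ₗ map τ τ
    ∘ₗ (TensorProduct.assoc F D C (D ⊗[F] C)).symm.toLinearMap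
    ∘ₗ lTensor D (TensorProduct.assoc F C D C).toLinearMap
    ∘ₗ lTensor D (rTensor C τ)
    ∘ₗ lTensor D (TensorProduct.assoc F D C C).symm.toLinearMap
    ∘ₗ (TensorProduct.assoc F D D (C ⊗[F] C)).toLinearMap := rfl
  rw [this]
  simp only [LinearMap.comp_apply, LinearEquiv.coe_coe, TensorProduct.assoc_tmul,
    TensorProduct.assoc_symm_tmul, LinearMap.lTensor_tmul, LinearMap.rTensor_tmul]
  induction τ (b' ⊗ₜ a) with
  | zero => simp
  | add u v hu hv => simp only [TensorProduct.add_tmul, TensorProduct.tmul_add, map_add, hu, hv]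
  | tmul c d => simp [twistTail_tmul]

theorem isTwistingMap_iff (τ : D ⊗[F] C →ₗ[F] C ⊗[F] D) :
    IsTwistingMap F C D τ ↔ (∀ a : C, τ (1 ⊗ₜ a) = a ⊗ₜ 1) ∧ (∀ b : D, τ (b ⊗ₜ 1) = 1 ⊗ₜ b) ∧
      ∀ (b b' : D) (a a' : C),
        τ ((b * b') ⊗ₜ (a * a')) = twistTail τ b a' (τ (b' ⊗ₜ a)) := by
  refine and_congr_right fun _ => and_congr_right fun _ => ⟨fun h b b' a a' => ?_, fun h => ?_⟩
  · rw [← twistRHS_tmul, ← h]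
    simp
  · apply TensorProduct.ext_fourfold'
    intro b b' a a'
    rw [twistRHS_tmul, ← h]
    simp

variable {τ : D ⊗[F] C →ₗ[F] C ⊗[F] D}

theorem map_mul_tmul (hτ : IsTwistingMap F C D τ) (b b' : D) (a : C) :
    τ ((b * b') ⊗ₜ a) =
      TensorProduct.lift ((LinearMap.mul F (C ⊗[F] D)).compl₁₂
        (τ ∘ₗ TensorProduct.mk F D C b) (TensorProduct.mk F C D 1)) (τ (b' ⊗ₜ a)) := by
  obtain ⟨-, h2, h3⟩ := (isTwistingMap_iff τ).1 hτ
  have := h3 b b' a 1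
  rw [mul_one] at this
  rw [this]
  induction τ (b' ⊗ₜ a) with
  | zero => simp
  | add u v hu hv => simp only [map_add, hu, hv]
  | tmul c d =>
    rw [twistTail_tmul, h2]
    simp only [lift.tmul, compl₁₂_apply, LinearMap.comp_apply, mk_apply, mul_apply']
    induction τ (b ⊗ₜ c) with
    | zero => simp
    | add u v hu hv => simp only [TensorProduct.add_tmul, map_add, hu, hv, add_mul]
    | tmul p q => simp [twistMul_tmul, h2]

theorem map_tmul_mul (hτ : IsTwistingMap F C D τ) (b : D) (a a' : C) :
    τ (b ⊗ₜ (a * a')) =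
      TensorProduct.lift ((LinearMap.mul F (C ⊗[F] D)).compl₁₂
        ((TensorProduct.mk F C D).flip 1) (τ ∘ₗ (TensorProduct.mk F D C).flip a'))
        (τ (b ⊗ₜ a)) := by
  obtain ⟨h1, -, h3⟩ := (isTwistingMap_iff τ).1 hτ
  have := h3 b 1 a a'
  rw [mul_one, h1, twistTail_tmul, h1] at this
  rw [this]
  induction τ (b ⊗ₜ a) with
  | zero => simp
  | add u v hu hv => simp only [TensorProduct.add_tmul, map_add, hu, hv]
  | tmul p q =>
    simp only [twistMul_tmul, lift.tmul, compl₁₂_apply, LinearMap.comp_apply, flip_apply, mk_apply,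
      mul_apply']
    induction τ (q ⊗ₜ a') with
    | zero => simp
    | add u v hu hv => simp only [map_add, hu, hv, mul_add]
    | tmul c d => simp

end General

section Comm

variable {F C D : Type*} [Field F] [CommRing C] [Algebra F C] [CommRing D] [Algebra F D]

/-- Conjugating a twisting map of commutative algebras by the flips gives a twisting map with the
roles of the algebras interchanged. -/
theorem isTwistingMap_comm {τ : D ⊗[F] C →ₗ[F] C ⊗[F] D} (hτ : IsTwistingMap F C D τ) :
    IsTwistingMap F D C ((TensorProduct.comm F C D).toLinearMap ∘ₗ τ ∘ₗ
      (TensorProduct.comm F C D).toLinearMap) := by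
  obtain ⟨h1, h2, h3⟩ := (isTwistingMap_iff τ).1 hτ
  refine (isTwistingMap_iff _).2 ⟨fun a => by simp [h2], fun b => by simp [h1], ?_⟩
  intro b b' a a'
  simp only [LinearMap.comp_apply, LinearEquiv.coe_coe, TensorProduct.comm_tmul]
  rw [mul_comm a, mul_comm b, h3]
  induction τ (a ⊗ₜ b') with
  | zero => simp
  | add u v hu hv => simp only [map_add, hu, hv]
  | tmul c d =>
    simp only [TensorProduct.comm_tmul, twistTail_tmul, LinearMap.comp_apply, LinearEquiv.coe_coe]
    induction τ (a' ⊗ₜ c) with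
    | zero => simp
    | add u v hu hv => simp only [TensorProduct.add_tmul, TensorProduct.tmul_add, map_add, hu, hv]
    | tmul p q =>
      induction τ (d ⊗ₜ b) with
      | zero => simp
      | add u v hu hv => simp only [TensorProduct.tmul_add, TensorProduct.add_tmul, map_add, hu, hv]
      | tmul r t =>
        simp only [TensorProduct.comm_tmul, twistMul_tmul, LinearMap.comp_apply,
          LinearEquiv.coe_coe]
        induction τ (q ⊗ₜ r) with
        | zero => simp
        | add u v hu hv => simp only [map_add, hu, hv]
        | tmul x y => simp [mul_comm]

end Comm

section Ore

open Polynomial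

variable {F C : Type*} [Field F] [CommRing C] [Algebra F C] (δ : Derivation F C C)

/-- Left multiplication by the variable in the Ore extension `C[y; δ]`, on `C ⊗ F[y]`. -/
def oreX : Module.End F (C ⊗[F] F[X]) :=
  rTensor F[X] δ.toLinearMap + LinearMap.mulLeft F (1 ⊗ₜ X)

@[simp]
theorem oreX_tmul (a : C) (b : F[X]) : oreX δ (a ⊗ₜ b) = δ a ⊗ₜ b + a ⊗ₜ (X * b) := by
  simp [oreX]

/-- The twisting map `b ⊗ a ↦ b(oreX) (a ⊗ 1)` of the Ore extension `C[y; δ]`. -/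
def oreTwist : F[X] ⊗[F] C →ₗ[F] C ⊗[F] F[X] :=
  TensorProduct.lift
    (((TensorProduct.mk F C F[X]).flip 1).lcomp F (C ⊗[F] F[X]) ∘ₗ (aeval (oreX δ)).toLinearMap)

theorem oreTwist_tmul (b : F[X]) (a : C) :
    oreTwist δ (b ⊗ₜ a) = aeval (oreX δ) b (a ⊗ₜ 1) := rfl

theorem commute_aeval_oreX {T : Module.End F (C ⊗[F] F[X])} (h : Commute T (oreX δ)) (b : F[X]) :
    Commute T (aeval (oreX δ) b) := by
  induction b using Polynomial.induction_on' with
  | add p q hp hq => simpa using hp.add_right hq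
  | monomial n c =>
    rw [aeval_monomial]
    exact (Algebra.commute_algebraMap_right c T).mul_right (h.pow_right n)

theorem aeval_oreX_one_tmul (b : F[X]) (d : F[X]) :
    aeval (oreX δ) b ((1 : C) ⊗ₜ[F] d) = 1 ⊗ₜ (b * d) := by
  induction b using Polynomial.induction_on generalizing d with
  | C c => simp [Algebra.algebraMap_eq_smul_one, ← smul_eq_C_mul]
  | add p q hp hq => simp [hp, hq, add_mul, TensorProduct.tmul_add]
  | monomial n c h =>
    rw [pow_succ, ← mul_assoc, map_mul, aeval_X, Module.End.mul_apply, oreX_tmul]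
    rw [Derivation.map_one_eq_zero, TensorProduct.zero_tmul, zero_add, h, mul_assoc _ X d]

/-- The map `a ⊗ b ↦ ℓ_a ∘ b(oreX)`, the left regular representation of the Ore extension. -/
def oreLeft : C ⊗[F] F[X] →ₗ[F] Module.End F (C ⊗[F] F[X]) :=
  TensorProduct.lift ((LinearMap.mul F (Module.End F (C ⊗[F] F[X]))).compl₁₂
    (LinearMap.mul F (C ⊗[F] F[X]) ∘ₗ (TensorProduct.mk F C F[X]).flip 1)
    (aeval (oreX δ)).toLinearMap)

theorem oreLeft_tmul (a : C) (b : F[X]) :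
    oreLeft δ (a ⊗ₜ b) = LinearMap.mulLeft F (a ⊗ₜ 1) * aeval (oreX δ) b := rfl

theorem oreX_mul_mulLeft (a : C) :
    oreX δ * LinearMap.mulLeft F (a ⊗ₜ[F] (1 : F[X])) =
      LinearMap.mulLeft F (δ a ⊗ₜ 1) + LinearMap.mulLeft F (a ⊗ₜ 1) * oreX δ := by
  apply TensorProduct.ext'
  intro c d
  simp [TensorProduct.add_tmul, mul_add, mul_comm]
  abel

theorem oreLeft_oreX (u : C ⊗[F] F[X]) : oreLeft δ (oreX δ u) = oreX δ * oreLeft δ u := by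
  induction u with
  | zero => simp
  | add u v hu hv => simp only [map_add, hu, hv, mul_add]
  | tmul a b =>
    rw [oreX_tmul, map_add, oreLeft_tmul, oreLeft_tmul, oreLeft_tmul, ← mul_assoc,
      oreX_mul_mulLeft, map_mul, aeval_X, add_mul, mul_assoc]

theorem oreLeft_aeval (b : F[X]) (u : C ⊗[F] F[X]) :
    oreLeft δ (aeval (oreX δ) b u) = aeval (oreX δ) b * oreLeft δ u := by
  induction b using Polynomial.induction_on generalizing u with
  | C c => simp [Algebra.algebraMap_eq_smul_one]
  | add p q hp hq => simp [hp, hq, add_mul]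
  | monomial n c h =>
    rw [pow_succ, ← mul_assoc, map_mul, aeval_X, Module.End.mul_apply, h, oreLeft_oreX, mul_assoc]

theorem oreLeft_oreTwist (b : F[X]) (a : C) :
    oreLeft δ (oreTwist δ (b ⊗ₜ a)) = aeval (oreX δ) b * LinearMap.mulLeft F (a ⊗ₜ 1) := by
  rw [oreTwist_tmul, oreLeft_aeval, oreLeft_tmul, map_one, mul_one]

theorem twistMul_oreTwist (u v : C ⊗[F] F[X]) :
    twistMul (oreTwist δ) (u ⊗ₜ v) = oreLeft δ u v := by
  induction u with
  | zero => simp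
  | add u u' hu hu' => simp only [TensorProduct.add_tmul, map_add, hu, hu', LinearMap.add_apply]
  | tmul p q =>
    induction v with
    | zero => simp
    | add v v' hv hv' => simp only [TensorProduct.tmul_add, map_add, hv, hv']
    | tmul r t =>
      rw [twistMul_tmul, oreTwist_tmul, oreLeft_tmul, Module.End.mul_apply]
      have hc : Commute (LinearMap.mulLeft F ((1 : C) ⊗ₜ[F] t)) (oreX δ) := by
        apply TensorProduct.ext'
        intro c d
        simp [mul_add, mul_left_comm]
      have h := LinearMap.congr_fun (commute_aeval_oreX δ hc q) (r ⊗ₜ 1)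
      have h' : r ⊗ₜ[F] t = LinearMap.mulLeft F ((1 : C) ⊗ₜ[F] t) (r ⊗ₜ 1) := by simp
      rw [Module.End.mul_apply, Module.End.mul_apply] at h
      rw [h', ← h]
      induction aeval (oreX δ) q (r ⊗ₜ 1) with
      | zero => simp
      | add u v hu hv => simp only [map_add, hu, hv]
      | tmul c d => simp [mul_comm]

theorem isTwistingMap_oreTwist : IsTwistingMap F C F[X] (oreTwist δ) := by
  refine (isTwistingMap_iff _).2 ⟨fun a => by simp [oreTwist_tmul],
    fun b => by simp [oreTwist_tmul, aeval_oreX_one_tmul], fun b b' a a' => ?_⟩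
  have key (u : C ⊗[F] F[X]) :
      twistTail (oreTwist δ) b a' u = aeval (oreX δ) b (oreLeft δ u (a' ⊗ₜ 1)) := by
    induction u with
    | zero => simp
    | add u v hu hv => simp only [map_add, hu, hv, LinearMap.add_apply]
    | tmul c d =>
      rw [twistTail_tmul, twistMul_oreTwist, oreLeft_oreTwist, oreTwist_tmul, oreLeft_tmul]
      simp only [Module.End.mul_apply]
  rw [key, oreLeft_oreTwist, oreTwist_tmul, map_mul]
  simp

theorem oreTwist_X_mul (b : F[X]) (a : C) :
    oreTwist δ ((X * b) ⊗ₜ a) = oreX δ (oreTwist δ (b ⊗ₜ a)) := by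
  simp [oreTwist_tmul]

theorem oreTwist_X_tmul (a : C) : oreTwist δ (X ⊗ₜ a) = a ⊗ₜ X + δ a ⊗ₜ 1 := by
  simp [oreTwist_tmul, add_comm]

theorem oreTwist_tmul_derivation (b : F[X]) (a : C) :
    oreTwist δ (b ⊗ₜ δ a) = rTensor F[X] δ.toLinearMap (oreTwist δ (b ⊗ₜ a)) := by
  have hc : Commute (rTensor F[X] δ.toLinearMap) (oreX δ) := by
    apply TensorProduct.ext'
    intro c d
    simp
  have := LinearMap.congr_fun (commute_aeval_oreX δ hc b) (a ⊗ₜ 1)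
  simpa [oreTwist_tmul] using this.symm

theorem comm_oreTwist_neg_comp_oreTwist :
    ((TensorProduct.comm F C F[X]).toLinearMap ∘ₗ oreTwist (-δ) ∘ₗ
      (TensorProduct.comm F C F[X]).toLinearMap) ∘ₗ oreTwist δ = LinearMap.id := by
  set ρ := oreTwist (-δ) ∘ₗ (TensorProduct.comm F C F[X]).toLinearMap with hρ
  have hX (u : C ⊗[F] F[X]) : ρ (oreX δ u) = LinearMap.mulLeft F (1 ⊗ₜ X) (ρ u) := by
    induction u with
    | zero => simp
    | add u v hu hv => simp only [map_add, hu, hv]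
    | tmul a b =>
      have h := oreTwist_tmul_derivation (-δ) b a
      have h' := oreTwist_X_mul (-δ) b a
      simp only [oreX, LinearMap.add_apply] at h'
      rw [← h] at h'
      simp [hρ, h', TensorProduct.tmul_neg]
  have h (b : F[X]) (a : C) : ρ (oreTwist δ (b ⊗ₜ a)) = a ⊗ₜ b := by
    rw [oreTwist_tmul]
    induction b using Polynomial.induction_on with
    | C c =>
      simp [hρ, oreTwist_tmul, Algebra.algebraMap_eq_smul_one, ← TensorProduct.tmul_smul,
        smul_eq_C_mul]
    | add p q hp hq => simp [hp, hq, TensorProduct.tmul_add]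
    | monomial n c h =>
      rw [pow_succ', mul_left_comm, map_mul, aeval_X, Module.End.mul_apply, hX, h]
      simp
  apply TensorProduct.ext'
  intro b a
  rw [LinearMap.comp_apply, LinearMap.comp_apply, h]
  simp

theorem oreTwist_comp_comm_oreTwist_neg :
    oreTwist δ ∘ₗ ((TensorProduct.comm F C F[X]).toLinearMap ∘ₗ oreTwist (-δ) ∘ₗ
      (TensorProduct.comm F C F[X]).toLinearMap) = LinearMap.id := by
  have h := comm_oreTwist_neg_comp_oreTwist (-δ)
  rw [neg_neg] at h
  refine LinearMap.ext fun u => (TensorProduct.comm F C F[X]).injective ?_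
  simpa using LinearMap.congr_fun h (TensorProduct.comm F C F[X] u)

end Ore

section Polynomial

open Polynomial

variable {F : Type*} [Field F]

/-- A twisting map of polynomial algebras with `τ (y ⊗ x) = x ⊗ y + p ⊗ 1` is determined by `p`. -/
theorem eq_of_apply_X_tmul_X {τ τ' : F[X] ⊗[F] F[X] →ₗ[F] F[X] ⊗[F] F[X]}
    (hτ : IsTwistingMap F F[X] F[X] τ) (hτ' : IsTwistingMap F F[X] F[X] τ') {p : F[X]}
    (h : τ (X ⊗ₜ X) = X ⊗ₜ X + p ⊗ₜ 1) (h' : τ' (X ⊗ₜ X) = X ⊗ₜ X + p ⊗ₜ 1) : τ = τ' := by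
  have hX (a : F[X]) : τ (X ⊗ₜ a) = τ' (X ⊗ₜ a) := by
    induction a using Polynomial.induction_on with
    | C c =>
      rw [← mul_one (C c), ← smul_eq_C_mul, TensorProduct.tmul_smul, map_smul, map_smul,
        hτ.2.1, hτ'.2.1]
    | add p q hp hq => simp only [TensorProduct.tmul_add, map_add, hp, hq]
    | monomial n c ih =>
      rw [pow_succ', mul_left_comm, map_tmul_mul hτ, map_tmul_mul hτ', h, h']
      simp [ih, hτ.1, hτ'.1]
  apply TensorProduct.ext'
  intro b a
  induction b using Polynomial.induction_on with
  | C c =>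
    rw [← mul_one (C c), ← smul_eq_C_mul, ← TensorProduct.smul_tmul', map_smul, map_smul,
      hτ.1, hτ'.1]
  | add p q hp hq => simp only [TensorProduct.add_tmul, map_add, hp, hq]
  | monomial n c ih =>
    rw [pow_succ', mul_left_comm, map_mul_tmul hτ, map_mul_tmul hτ', ih]
    have : τ ∘ₗ TensorProduct.mk F F[X] F[X] X = τ' ∘ₗ TensorProduct.mk F F[X] F[X] X :=
      LinearMap.ext hX
    rw [this]

/-- The derivation `x² d/dx` of `F[x]`. -/
def jordanDerivation (F : Type*) [Field F] : Derivation F F[X] F[X] :=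
  (X ^ 2 : F[X]) • Polynomial.derivative'

theorem jordanDerivation_X : jordanDerivation F X = X ^ 2 := by
  simp [jordanDerivation, Polynomial.derivative']

end Polynomial

end TwistingMap

open Polynomial in
/-- For `A = k[x]`, `B = k[y]`, there is a unique twisting map
`τ : B ⊗ A → A ⊗ B` with `τ(y ⊗ x) = x ⊗ y + x² ⊗ 1`; moreover `τ` is bijective
and its inverse is the unique twisting map (roles of `A` and `B` interchanged)
satisfying `τ⁻¹(x ⊗ y) = y ⊗ x − 1 ⊗ x²`. -/
theorem jordan_twisting_map (k : Type*) [Field k] :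
    (∃! τ : (Polynomial k) ⊗[k] (Polynomial k) →ₗ[k] (Polynomial k) ⊗[k] (Polynomial k),
      IsTwistingMap k (Polynomial k) (Polynomial k) τ ∧
        τ (X ⊗ₜ[k] X) = X ⊗ₜ[k] X + (X ^ 2) ⊗ₜ[k] 1) ∧
    (∀ τ : (Polynomial k) ⊗[k] (Polynomial k) →ₗ[k] (Polynomial k) ⊗[k] (Polynomial k),
      (IsTwistingMap k (Polynomial k) (Polynomial k) τ ∧
          τ (X ⊗ₜ[k] X) = X ⊗ₜ[k] X + (X ^ 2) ⊗ₜ[k] 1) →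
        Function.Bijective τ ∧
        ∃ σ : (Polynomial k) ⊗[k] (Polynomial k) →ₗ[k] (Polynomial k) ⊗[k] (Polynomial k),
          σ ∘ₗ τ = LinearMap.id ∧ τ ∘ₗ σ = LinearMap.id ∧
          (∀ σ' : (Polynomial k) ⊗[k] (Polynomial k) →ₗ[k] (Polynomial k) ⊗[k] (Polynomial k),
            (IsTwistingMap k (Polynomial k) (Polynomial k) σ' ∧
                σ' (X ⊗ₜ[k] X) = X ⊗ₜ[k] X - (1 : Polynomial k) ⊗ₜ[k] (X ^ 2)) ↔ σ' = σ)) := by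
  have hτ := TwistingMap.isTwistingMap_oreTwist (TwistingMap.jordanDerivation k)
  have hX : TwistingMap.oreTwist (TwistingMap.jordanDerivation k) (X ⊗ₜ[k] X) =
      X ⊗ₜ[k] X + (X ^ 2) ⊗ₜ[k] 1 := by
    rw [TwistingMap.oreTwist_X_tmul, TwistingMap.jordanDerivation_X]
  have hν := TwistingMap.isTwistingMap_oreTwist (-TwistingMap.jordanDerivation k)
  have hνX : TwistingMap.oreTwist (-TwistingMap.jordanDerivation k) (X ⊗ₜ[k] X) =
      X ⊗ₜ[k] X + (-X ^ 2) ⊗ₜ[k] 1 := by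
    rw [TwistingMap.oreTwist_X_tmul, Derivation.neg_apply, TwistingMap.jordanDerivation_X]
  have hl := TwistingMap.comm_oreTwist_neg_comp_oreTwist (TwistingMap.jordanDerivation k)
  have hr := TwistingMap.oreTwist_comp_comm_oreTwist_neg (TwistingMap.jordanDerivation k)
  refine ⟨⟨_, ⟨hτ, hX⟩, fun τ h => TwistingMap.eq_of_apply_X_tmul_X h.1 hτ h.2 hX⟩, ?_⟩
  rintro τ ⟨h, h'⟩
  obtain rfl := TwistingMap.eq_of_apply_X_tmul_X h hτ h' hX
  refine ⟨Function.bijective_iff_has_inverse.2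
    ⟨_, fun x => LinearMap.congr_fun hl x, fun x => LinearMap.congr_fun hr x⟩, _, hl, hr, fun σ => ⟨?_, ?_⟩⟩
  · rintro ⟨hσ, hσX⟩
    have hs := TwistingMap.eq_of_apply_X_tmul_X (TwistingMap.isTwistingMap_comm hσ) hν
      (by simp [hσX, TensorProduct.neg_tmul, sub_eq_add_neg]) hνX
    rw [← hs]
    refine LinearMap.ext fun u => ?_
    simp [LinearMap.comp_apply]
  · rintro rfl
    refine ⟨TwistingMap.isTwistingMap_comm hν, ?_⟩
    simp [hνX, TensorProduct.tmul_neg, sub_eq_add_neg]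

end
end

section
/- Let k be a field of characteristic 0 and let J = k⟨x,y⟩/(yx − xy − x²) be the Jordan plane over k. Then the center of J consists exactly of the scalar multiples of the identity: Z(J) = k·1. -/
open TensorProduct LinearMap

noncomputable section

variable (k : Type*) [Field k]

/-- The defining relation of the Jordan plane: `y x = x y + x²`. -/
def jordanRel : FreeAlgebra k (Fin 2) → FreeAlgebra k (Fin 2) → Prop :=
  fun a b =>
    a = FreeAlgebra.ι k (1 : Fin 2) * FreeAlgebra.ι k (0 : Fin 2) ∧
    b = FreeAlgebra.ι k (0 : Fin 2) * FreeAlgebra.ι k (1 : Fin 2) +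
        FreeAlgebra.ι k (0 : Fin 2) * FreeAlgebra.ι k (0 : Fin 2)

/-- The Jordan plane `k⟨x,y⟩/(yx − xy − x²)`. -/
def Jordan : Type _ := RingQuot (jordanRel k)

instance : Ring (Jordan k) := by unfold Jordan; infer_instance
instance : Algebra k (Jordan k) := by unfold Jordan; infer_instance

/-- The image of the generator `x` in the Jordan plane. -/
def jx : Jordan k := RingQuot.mkAlgHom k (jordanRel k) (FreeAlgebra.ι k (0 : Fin 2))

/-- The image of the generator `y` in the Jordan plane. -/
def jy : Jordan k := RingQuot.mkAlgHom k (jordanRel k) (FreeAlgebra.ι k (1 : Fin 2))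

theorem jy_mul_jx : jy k * jx k = jx k * jy k + jx k * jx k := by
  have h := RingQuot.mkAlgHom_rel k (s := jordanRel k) ⟨rfl, rfl⟩
  rw [map_mul, map_add, map_mul, map_mul] at h
  exact h

theorem jordan_induction {motive : Jordan k → Prop}
    (algebraMap : ∀ r, motive (algebraMap k (Jordan k) r))
    (jx : motive (jx k)) (jy : motive (jy k))
    (mul : ∀ a b, motive a → motive b → motive (a * b))
    (add : ∀ a b, motive a → motive b → motive (a + b)) (a : Jordan k) : motive a := by
  obtain ⟨a, rfl⟩ := RingQuot.mkAlgHom_surjective k (jordanRel k) a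
  induction a using FreeAlgebra.induction with
  | grade0 r => rw [AlgHom.commutes]; exact algebraMap r
  | grade1 i => fin_cases i <;> assumption
  | mul a b ha hb => rw [map_mul]; exact mul _ _ ha hb
  | add a b ha hb => rw [map_add]; exact add _ _ ha hb

/-- The ordered monomials `x ^ i * y ^ j` of the Jordan plane. -/
def jordanMonomial (p : ℕ × ℕ) : Jordan k := jx k ^ p.1 * jy k ^ p.2

theorem jy_mul_jx_pow (i : ℕ) :
    jy k * jx k ^ i = jx k ^ i * jy k + (i : k) • jx k ^ (i + 1) := by
  induction i with
  | zero => simp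
  | succ i ih =>
    rw [pow_succ, ← mul_assoc, ih, add_mul, mul_assoc, jy_mul_jx, smul_mul_assoc, Nat.cast_succ,
      add_smul, one_smul, mul_add, pow_succ (jx k) (i + 1), pow_succ (jx k) i]
    simp only [mul_assoc]
    abel

theorem span_jordanMonomial : Submodule.span k (Set.range (jordanMonomial k)) = ⊤ := by
  set S := Submodule.span k (Set.range (jordanMonomial k))
  have hmem (i j : ℕ) : jx k ^ i * jy k ^ j ∈ S := Submodule.subset_span ⟨(i, j), rfl⟩
  have hmul (a : Jordan k) : ∀ s ∈ S, a * s ∈ S := by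
    induction a using jordan_induction with
    | algebraMap r =>
      intro s hs
      rw [← Algebra.smul_def]
      exact S.smul_mem r hs
    | jx =>
      intro s hs
      induction hs using Submodule.span_induction with
      | mem s hs =>
        obtain ⟨⟨i, j⟩, rfl⟩ := hs
        rw [jordanMonomial, ← mul_assoc, ← pow_succ']
        exact hmem _ _
      | zero => simp
      | add s t _ _ hs ht => rw [mul_add]; exact S.add_mem hs ht
      | smul c s _ hs => rw [mul_smul_comm]; exact S.smul_mem c hs
    | jy =>
      intro s hs
      induction hs using Submodule.span_induction with
      | mem s hs =>
        obtain ⟨⟨i, j⟩, rfl⟩ := hs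
        rw [jordanMonomial, ← mul_assoc, jy_mul_jx_pow, add_mul, mul_assoc, ← pow_succ',
          smul_mul_assoc]
        exact S.add_mem (hmem _ _) (S.smul_mem _ (hmem _ _))
      | zero => simp
      | add s t _ _ hs ht => rw [mul_add]; exact S.add_mem hs ht
      | smul c s _ hs => rw [mul_smul_comm]; exact S.smul_mem c hs
    | mul a b ha hb => intro s hs; rw [mul_assoc]; exact ha _ (hb _ hs)
    | add a b ha hb => intro s hs; rw [add_mul]; exact S.add_mem (ha _ hs) (hb _ hs)
  refine Submodule.eq_top_iff'.mpr fun a => ?_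
  simpa using hmul a 1 (by simpa using hmem 0 0)

open Polynomial

/-- The operator `t² d/dt + n t` on `k[n][t]`. -/
def jordanRepY : Module.End k[X] k[X][X] :=
  LinearMap.mulLeft k[X] (X ^ 2) ∘ₗ derivative + LinearMap.mulLeft k[X] (C X * X)

theorem jordanRepY_apply (f : k[X][X]) :
    jordanRepY k f = X ^ 2 * derivative f + C X * X * f := by
  simp [jordanRepY, mul_assoc]

/-- The representation of the Jordan plane on `k[n][t]` in which `x` acts by multiplication by `t`
and `y` acts by `t² d/dt + n t`. -/
def jordanRep : Jordan k →ₐ[k] Module.End k[X] k[X][X] :=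
  RingQuot.liftAlgHom k (s := jordanRel k)
    ⟨FreeAlgebra.lift k ![LinearMap.mulLeft k[X] X, jordanRepY k], by
      rintro _ _ ⟨rfl, rfl⟩
      refine LinearMap.ext fun f => ?_
      simp [jordanRepY_apply]
      ring⟩

theorem jordanRep_jx_apply (f : k[X][X]) : jordanRep k (jx k) f = X * f := by
  have h : jordanRep k (jx k) = LinearMap.mulLeft k[X] X :=
    (RingQuot.liftAlgHom_mkAlgHom_apply k _ _ _).trans (by simp)
  simp [h]

theorem jordanRep_jy_apply (f : k[X][X]) :
    jordanRep k (jy k) f = X ^ 2 * derivative f + C X * X * f := by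
  have h : jordanRep k (jy k) = jordanRepY k :=
    (RingQuot.liftAlgHom_mkAlgHom_apply k _ _ _).trans (by simp)
  rw [h, jordanRepY_apply]

theorem jordanRep_jx_pow_apply (i : ℕ) (f : k[X][X]) :
    jordanRep k (jx k ^ i) f = X ^ i * f := by
  induction i with
  | zero => simp
  | succ i ih => rw [pow_succ', map_mul, Module.End.mul_apply, ih, jordanRep_jx_apply]; ring

theorem jordanRep_jy_pow_one (j : ℕ) :
    jordanRep k (jy k ^ j) 1 = C (ascPochhammer k j) * X ^ j := by
  induction j with
  | zero => simp
  | succ j ih =>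
    rw [pow_succ', map_mul, Module.End.mul_apply, ih, jordanRep_jy_apply,
      ascPochhammer_succ_right, derivative_C_mul, derivative_X_pow]
    cases j with
    | zero => simp
    | succ j => simp; ring

theorem jordanRep_jordanMonomial_one (p : ℕ × ℕ) :
    jordanRep k (jordanMonomial k p) 1 = ascPochhammer k p.2 • X ^ (p.1 + p.2) := by
  rw [jordanMonomial, map_mul, Module.End.mul_apply, jordanRep_jy_pow_one,
    jordanRep_jx_pow_apply, smul_eq_C_mul]
  ring

theorem linearIndependent_ascPochhammer : LinearIndependent k (ascPochhammer k) :=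
  Sequence.linearIndependent
    ⟨ascPochhammer k, fun i => by
      rw [degree_eq_natDegree (monic_ascPochhammer k i).ne_zero, ascPochhammer_natDegree]⟩

theorem linearIndependent_ascPochhammer_smul_X_pow :
    LinearIndependent k
      fun p : ℕ × ℕ => ascPochhammer k p.2 • (X ^ (p.1 + p.2) : k[X][X]) := by
  have hX : LinearIndependent k[X] fun m : ℕ => (X ^ m : k[X][X]) := by
    simpa [monomial_one_right_eq_X_pow] using
      (Polynomial.basisMonomials k[X]).linearIndependent
  refine (linearIndependent_smul (linearIndependent_ascPochhammer k) hX).comp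
    (fun p : ℕ × ℕ => (p.2, p.1 + p.2)) fun p q h => ?_
  simp only [Prod.mk.injEq] at h
  ext <;> omega

theorem jordanRep_apply_one_injective :
    Function.Injective fun a : Jordan k => jordanRep k a 1 := by
  let e : Jordan k →ₗ[k] k[X][X] :=
    { toFun := fun a => jordanRep k a 1
      map_add' := by simp
      map_smul' := by simp }
  have he : LinearIndependent k (e ∘ jordanMonomial k) := by
    convert linearIndependent_ascPochhammer_smul_X_pow k using 1
    exact funext (jordanRep_jordanMonomial_one k)
  refine (injective_iff_map_eq_zero e).mpr fun a ha => ?_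
  obtain ⟨c, rfl⟩ : a ∈ LinearMap.range (Finsupp.linearCombination k (jordanMonomial k)) := by
    rw [Finsupp.range_linearCombination, span_jordanMonomial]
    trivial
  rw [Finsupp.apply_linearCombination] at ha
  rw [linearIndependent_iff.mp he c ha, map_zero]

theorem coeff_zero_jordanRep_apply_one (a : Jordan k) :
    ∃ c : k, (jordanRep k a 1).coeff 0 = C c := by
  have ha : a ∈ Submodule.span k (Set.range (jordanMonomial k)) := by
    rw [span_jordanMonomial]
    trivial
  induction ha using Submodule.span_induction with
  | mem a ha =>
    obtain ⟨⟨i, j⟩, rfl⟩ := ha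
    rw [jordanRep_jordanMonomial_one, coeff_smul, coeff_X_pow]
    by_cases h : 0 = i + j
    · obtain rfl : j = 0 := by omega
      exact ⟨1, by simp [← h]⟩
    · exact ⟨0, by simp [h]⟩
  | zero => exact ⟨0, by simp⟩
  | add a b _ _ ha hb =>
    obtain ⟨c, hc⟩ := ha
    obtain ⟨d, hd⟩ := hb
    exact ⟨c + d, by simp [hc, hd]⟩
  | smul r a _ ha =>
    obtain ⟨c, hc⟩ := ha
    exact ⟨r * c, by simp [hc, smul_eq_C_mul]⟩

theorem derivative_jordanRep_apply_one {z : Jordan k} (hx : z * jx k = jx k * z)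
    (hy : z * jy k = jy k * z) : derivative (jordanRep k z 1) = 0 := by
  have hzx := LinearMap.congr_fun (congrArg (jordanRep k) hx) 1
  have hzy := LinearMap.congr_fun (congrArg (jordanRep k) hy) 1
  simp only [map_mul, Module.End.mul_apply, jordanRep_jx_apply, jordanRep_jy_apply, mul_one,
    derivative_one, mul_zero, zero_add] at hzx hzy
  rw [← smul_eq_C_mul, map_smul, hzx, smul_eq_C_mul, smul_eq_C_mul, mul_assoc, right_eq_add] at hzy
  exact (mul_eq_zero.mp hzy).resolve_left (pow_ne_zero 2 X_ne_zero)

/-- In characteristic `0`, the center of the Jordan plane consists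
exactly of the scalar multiples of the identity. -/
theorem jordan_center [CharZero k] :
    Subalgebra.center k (Jordan k) = ⊥ := by
  refine eq_bot_iff.mpr fun z hz => ?_
  have hcomm (a : Jordan k) : z * a = a * z := (Subalgebra.mem_center_iff.mp hz a).symm
  have hconst := eq_C_of_derivative_eq_zero
    (derivative_jordanRep_apply_one k (hcomm (jx k)) (hcomm (jy k)))
  obtain ⟨c, hc⟩ := coeff_zero_jordanRep_apply_one k z
  refine Algebra.mem_bot.mpr ⟨c, jordanRep_apply_one_injective k ?_⟩
  change jordanRep k (algebraMap k (Jordan k) c) 1 = jordanRep k z 1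
  rw [hconst, hc, AlgHom.commutes, Module.algebraMap_end_apply, Algebra.smul_def, mul_one]
  rfl

end
end

section
/- Let k be a field of characteristic 0 and let J = k⟨x,y⟩/(yx − xy − x²) be the Jordan plane over k. Then for every k-linear derivation ∂ : J → J there exist a scalar α ∈ k, a polynomial p ∈ k[Y], and an element w ∈ J such that ∂(y) = α x + p(y) + (w y − y w) and ∂(x) = p'(y) x + (w x − x w), where p' denotes the formal derivative of p and p(y), p'(y) denote the evaluations of p, p' at the element y of J. -/
open TensorProduct LinearMap

noncomputable section

variable (k : Type*) [Field k]

namespace Jordan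

open Polynomial

/-- The quotient map from the free algebra. -/
def mk : FreeAlgebra k (Fin 2) →ₐ[k] Jordan k := RingQuot.mkAlgHom k (jordanRel k)

lemma mk_surjective : Function.Surjective (mk k) :=
  RingQuot.mkAlgHom_surjective k (jordanRel k)

lemma jy_mul_jx : jy k * jx k = jx k * jy k + jx k * jx k := by
  have h := RingQuot.mkAlgHom_rel k (s := jordanRel k) ⟨rfl, rfl⟩
  rw [map_mul, map_add, map_mul, map_mul] at h
  exact h

lemma commute_jy_aeval (p : k[X]) : Commute (jy k) (aeval (jy k) p) := by
  simpa using (Commute.all (X : k[X]) p).map (aeval (jy k))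

/-- The commutation rule `p(y) x = x p(y) + x p'(y) x`. -/
lemma aeval_mul_jx (p : k[X]) :
    aeval (jy k) p * jx k =
      jx k * aeval (jy k) p + jx k * aeval (jy k) (derivative p) * jx k := by
  induction p using Polynomial.induction_on with
  | C a => simpa using Algebra.commutes a (jx k)
  | add p q hp hq =>
    simp only [map_add, add_mul, mul_add, hp, hq]
    abel
  | monomial n a ih =>
    rw [pow_succ, ← mul_assoc]
    generalize C a * X ^ n = q at ih ⊢
    simp only [derivative_mul, derivative_X, mul_one, map_mul, map_add, aeval_X]
    rw [mul_assoc, jy_mul_jx, mul_add, ← mul_assoc, ← mul_assoc, ih]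
    have h := jy_mul_jx k
    calc _ = jx k * aeval (jy k) q * jy k + jx k * aeval (jy k) q * jx k
          + jx k * aeval (jy k) (derivative q) * (jx k * jy k + jx k * jx k) := by noncomm_ring
      _ = _ := by rw [← h]; noncomm_ring

/-- The operator `Y + X² d/dX` on `k[Y][X]`, by which `y` acts. -/
def yOp : Module.End k k[X][X] :=
  LinearMap.mulLeft k (C X) + LinearMap.mulLeft k (X ^ 2) ∘ₗ derivative.restrictScalars k

lemma yOp_apply (m : k[X][X]) : yOp k m = C X * m + X ^ 2 * derivative m := rfl

/-- The representation of the Jordan plane on `k[Y][X]` in which `x` acts by multiplication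
by `X` and `y` acts by `yOp`. -/
def rep : Jordan k →ₐ[k] Module.End k k[X][X] :=
  RingQuot.liftAlgHom k ⟨FreeAlgebra.lift k ![LinearMap.mulLeft k X, yOp k], by
    rintro _ _ ⟨rfl, rfl⟩
    refine LinearMap.ext fun m => ?_
    simp [yOp_apply]
    ring⟩

lemma rep_mk (a : FreeAlgebra k (Fin 2)) :
    rep k (mk k a) =
      FreeAlgebra.lift k ![LinearMap.mulLeft k X, yOp k] a :=
  RingQuot.liftAlgHom_mkAlgHom_apply ..

lemma rep_jx (m : k[X][X]) : rep k (jx k) m = X * m := by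
  change rep k (mk k _) m = _
  simp [rep_mk]

lemma rep_jy (m : k[X][X]) : rep k (jy k) m = yOp k m := by
  change rep k (mk k _) m = _
  simp [rep_mk]

/-- The normal form map sending `∑ Xⁱ pᵢ(Y)` to `∑ xⁱ pᵢ(y)`. -/
def ofPoly : k[X][X] →ₗ[k] Jordan k :=
  Polynomial.lsum fun i => Algebra.lmul k (Jordan k) (jx k ^ i) ∘ₗ (aeval (jy k)).toLinearMap

lemma ofPoly_monomial (i : ℕ) (p : k[X]) :
    ofPoly k (monomial i p) = jx k ^ i * aeval (jy k) p := by
  simp [ofPoly, Polynomial.lsum, sum_monomial_index]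

lemma ofPoly_C (p : k[X]) : ofPoly k (C p) = aeval (jy k) p := by
  rw [← monomial_zero_left, ofPoly_monomial, pow_zero, one_mul]

lemma ofPoly_X_mul (m : k[X][X]) : ofPoly k (X * m) = jx k * ofPoly k m := by
  induction m using Polynomial.induction_on' with
  | add p q hp hq => simp only [mul_add, map_add, hp, hq]
  | monomial i p => rw [X_mul_monomial, ofPoly_monomial, ofPoly_monomial, pow_succ', mul_assoc]

lemma ofPoly_mul_jy (m : k[X][X]) : ofPoly k m * jy k = ofPoly k (C X * m) := by
  induction m using Polynomial.induction_on' with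
  | add p q hp hq => simp only [mul_add, add_mul, map_add, hp, hq]
  | monomial i p =>
    rw [C_mul_monomial, ofPoly_monomial, ofPoly_monomial, map_mul, aeval_X, mul_assoc,
      (commute_jy_aeval k p).eq]

lemma jy_mul_jx_pow (i : ℕ) :
    jy k * jx k ^ i = jx k ^ i * jy k + i • jx k ^ (i + 1) := by
  induction i with
  | zero => simp
  | succ i ih =>
    rw [pow_succ, ← mul_assoc, ih, add_mul, mul_assoc, jy_mul_jx, succ_nsmul, smul_mul_assoc,
      pow_succ (jx k) (i + 1), pow_succ]
    noncomm_ring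

lemma jy_mul_ofPoly (m : k[X][X]) : jy k * ofPoly k m = ofPoly k (yOp k m) := by
  induction m using Polynomial.induction_on' with
  | add p q hp hq => simp only [mul_add, map_add, hp, hq]
  | monomial i p =>
    rw [yOp_apply, map_add, ← ofPoly_mul_jy, pow_two, mul_assoc, ofPoly_X_mul, ofPoly_X_mul,
      derivative_monomial, ofPoly_monomial, ← mul_assoc, jy_mul_jx_pow, ofPoly_monomial,
      map_mul, map_natCast, add_mul, mul_assoc, mul_assoc, (commute_jy_aeval k p).eq]
    congr 1
    cases i with
    | zero => simp
    | succ i =>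
      rw [← nsmul_eq_mul', Nat.add_sub_cancel, pow_succ', pow_succ']
      simp only [mul_assoc, smul_mul_assoc, mul_smul_comm]

lemma rep_aeval_jy_C (p q : k[X]) : rep k (aeval (jy k) p) (C q) = C (p * q) := by
  induction p using Polynomial.induction_on generalizing q with
  | C a => simp [Algebra.smul_def]
  | add p q hp hq => simp [hp, hq, add_mul]
  | monomial n a ih =>
    rw [pow_succ, ← mul_assoc, map_mul, map_mul, Module.End.mul_apply, aeval_X, rep_jy,
      yOp_apply, derivative_C, mul_zero, add_zero, ← C_mul, ih]
    ring_nf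

lemma rep_ofPoly_one (m : k[X][X]) : rep k (ofPoly k m) 1 = m := by
  induction m using Polynomial.induction_on' with
  | add p q hp hq => simp only [map_add, LinearMap.add_apply, hp, hq]
  | monomial i p =>
    rw [ofPoly_monomial, map_mul, Module.End.mul_apply, ← C_1, rep_aeval_jy_C, mul_one]
    induction i with
    | zero => simp
    | succ i ih => rw [pow_succ', map_mul, Module.End.mul_apply, ih, rep_jx, X_mul_monomial]

lemma ofPoly_rep (u : Jordan k) (m : k[X][X]) : ofPoly k (rep k u m) = u * ofPoly k m := by
  obtain ⟨a, rfl⟩ := mk_surjective k u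
  induction a using FreeAlgebra.induction generalizing m with
  | grade0 r =>
    rw [AlgHom.commutes, AlgHom.commutes, Module.algebraMap_end_apply, map_smul,
      Algebra.smul_def]
  | grade1 i =>
    fin_cases i
    · exact (congrArg _ (rep_jx k m)).trans (ofPoly_X_mul k m)
    · exact (congrArg _ (rep_jy k m)).trans (jy_mul_ofPoly k m).symm
  | mul a b ha hb =>
    rw [map_mul, map_mul, Module.End.mul_apply, ha, hb, mul_assoc]
  | add a b ha hb =>
    rw [map_add, map_add, LinearMap.add_apply, map_add, ha, hb, add_mul]

/-- The normal form of elements of the Jordan plane: a linear isomorphism with `k[Y][X]`. -/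
def polyEquiv : k[X][X] ≃ₗ[k] Jordan k :=
  .ofBijective (ofPoly k)
    ⟨Function.LeftInverse.injective (g := fun u => rep k u 1) (rep_ofPoly_one k),
      fun u => ⟨rep k u 1, by
      rw [ofPoly_rep, ← C_1, ofPoly_C, map_one, mul_one]⟩⟩

lemma polyEquiv_apply (m : k[X][X]) : polyEquiv k m = ofPoly k m := rfl

/-- Right multiplication by `x`, in normal form. -/
def rightX : k[X][X] →ₗ[k] k[X][X] :=
  (polyEquiv k).symm.toLinearMap ∘ₗ
    (Algebra.lmul k (Jordan k)).toLinearMap.flip (jx k) ∘ₗ (polyEquiv k).toLinearMap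

lemma ofPoly_rightX (m : k[X][X]) : ofPoly k (rightX k m) = ofPoly k m * jx k :=
  (polyEquiv k).apply_symm_apply _

lemma ofPoly_injective : Function.Injective (ofPoly k) := (polyEquiv k).injective

lemma rightX_X_mul (m : k[X][X]) : rightX k (X * m) = X * rightX k m :=
  ofPoly_injective k <| by simp only [ofPoly_rightX, ofPoly_X_mul, mul_assoc]

lemma rightX_X_pow_mul (n : ℕ) (m : k[X][X]) : rightX k (X ^ n * m) = X ^ n * rightX k m := by
  induction n with
  | zero => simp
  | succ n ih => rw [pow_succ', mul_assoc, rightX_X_mul, ih, mul_assoc]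

lemma rightX_C (p : k[X]) :
    rightX k (C p) = X * C p + X * rightX k (C (derivative p)) :=
  ofPoly_injective k <| by
    simp only [map_add, ofPoly_rightX, ofPoly_X_mul, ofPoly_C, aeval_mul_jx k p, mul_assoc]

lemma coeff_rightX_zero (m : k[X][X]) : (rightX k m).coeff 0 = 0 := by
  rw [← X_mul_divX_add m, map_add, rightX_X_mul, rightX_C]
  simp

lemma coeff_rightX_one (m : k[X][X]) : (rightX k m).coeff 1 = m.coeff 0 := by
  conv_lhs => rw [← X_mul_divX_add m, map_add, rightX_X_mul, rightX_C]
  simp [coeff_X_mul, coeff_rightX_zero]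

lemma coeff_rightX_succ {n : ℕ} {m : k[X][X]} (h : X ^ n ∣ m) :
    (rightX k m).coeff (n + 1) = m.coeff n := by
  obtain ⟨m, rfl⟩ := h
  rw [rightX_X_pow_mul, add_comm n, coeff_X_pow_mul, coeff_rightX_one]
  simpa using (coeff_X_pow_mul m n 0).symm

lemma exists_derivative_eq [CharZero k] {R : Type*} [CommRing R] [Algebra k R] (f : R[X]) :
    ∃ g : R[X], derivative g = f := by
  induction f using Polynomial.induction_on' with
  | add p q hp hq =>
    obtain ⟨g, rfl⟩ := hp
    obtain ⟨h, rfl⟩ := hq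
    exact ⟨g + h, map_add ..⟩
  | monomial n a =>
    refine ⟨monomial (n + 1) (algebraMap k R ((n + 1 : k)⁻¹) * a), ?_⟩
    rw [derivative_monomial, Nat.add_sub_cancel, mul_right_comm,
      ← map_natCast (algebraMap k R) (n + 1), ← map_mul, Nat.cast_succ,
      inv_mul_cancel₀ (Nat.cast_add_one_ne_zero n), map_one, one_mul]

lemma eq_zero_of_homogeneous [CharZero k] {B : k[X][X]}
    (h : X ^ 2 * derivative B = rightX k B + X * B) (h2 : B.coeff 2 = 0) : B = 0 := by
  suffices H : ∀ n, ∀ d < n, B.coeff d = 0 from ext fun n => H (n + 1) n n.lt_succ_self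
  intro n
  induction n with
  | zero => simp
  | succ n ih =>
    intro d hd
    obtain hd | rfl := Nat.lt_succ_iff_lt_or_eq.mp hd
    · exact ih d hd
    have hc := congrArg (coeff · (d + 1)) h
    simp only [coeff_add, coeff_X_mul, coeff_rightX_succ k (X_pow_dvd_iff.mpr ih)] at hc
    match d, hc, ih with
    | 0, hc, _ => simpa [coeff_X_pow_mul', ← two_mul] using hc
    | 1, hc, _ =>
      rw [show 1 + 1 = 0 + 2 from rfl, coeff_X_pow_mul, coeff_derivative] at hc
      simpa using hc
    | 2, _, _ => exact h2
    | d + 3, hc, _ =>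
      rw [show d + 3 + 1 = (d + 2) + 2 by ring, coeff_X_pow_mul, coeff_derivative] at hc
      have : B.coeff (d + 3) * ((d + 1 : ℕ) : k[X]) = 0 := by
        push_cast at hc ⊢
        linear_combination hc
      exact (mul_eq_zero.mp this).resolve_right (Nat.cast_ne_zero.mpr d.succ_ne_zero)

lemma derivative_eq_zero_of_relation [CharZero k] {a : k[X]} {B : k[X][X]}
    (h : rightX k (X * C a) + X ^ 2 * derivative B = X * (X * C a) + rightX k B + X * B) :
    derivative a = 0 := by
  rw [rightX_X_mul, rightX_C] at h
  replace h : X ^ 2 * (rightX k (C (derivative a)) + derivative B) = rightX k B + X * B := by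
    linear_combination h
  have key (n : ℕ) (hn : ∀ d < n, B.coeff d = 0) :
      (X ^ 2 * (rightX k (C (derivative a)) + derivative B)).coeff (n + 1) =
        B.coeff n + B.coeff n := by
    rw [h, coeff_add, coeff_X_mul, coeff_rightX_succ k (X_pow_dvd_iff.mpr hn)]
  have h0 : B.coeff 0 = 0 := by
    simpa [coeff_X_pow_mul', ← two_mul] using key 0 (by simp)
  have h1 : B.coeff 1 = 0 := by
    have := key 1 (by simpa using h0)
    rw [show 1 + 1 = 0 + 2 from rfl, coeff_X_pow_mul, coeff_add, coeff_rightX_zero,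
      coeff_derivative] at this
    simpa using this
  have := key 2 (by
    intro d hd
    interval_cases d <;> assumption)
  rw [show 2 + 1 = 1 + 2 from rfl, coeff_X_pow_mul, coeff_add, coeff_rightX_one,
    coeff_derivative, coeff_C_zero] at this
  push_cast at this
  linear_combination this

/-- The equation on normal forms `A` of `∂ y` and `B` of `∂ x` imposed by the relation. -/
lemma relation_normalForm {A B : k[X][X]}
    (h : ofPoly k A * jx k + jy k * ofPoly k B =
      ofPoly k B * jy k + jx k * ofPoly k A + (ofPoly k B * jx k + jx k * ofPoly k B)) :
    rightX k A + X ^ 2 * derivative B = X * A + rightX k B + X * B := by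
  simp only [← ofPoly_rightX, jy_mul_ofPoly, ofPoly_mul_jy, ← ofPoly_X_mul, ← map_add] at h
  have := ofPoly_injective k h
  rw [yOp_apply] at this
  linear_combination this

end Jordan

open Polynomial in
/-- In characteristic `0`, every `k`-linear derivation `∂` of the
Jordan plane has the form `∂(y) = α x + p(y) + (wy − yw)`, `∂(x) = p'(y) x + (wx − xw)`
for some `α ∈ k`, `p ∈ k[Y]`, `w ∈ J`. -/
theorem jordan_derivations [CharZero k]
    (D : Jordan k →ₗ[k] Jordan k)
    (hD : ∀ u v : Jordan k, D (u * v) = D u * v + u * D v) :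
    ∃ (α : k) (p : Polynomial k) (w : Jordan k),
      D (jy k) = α • jx k + aeval (jy k) p + (w * jy k - jy k * w) ∧
      D (jx k) = aeval (jy k) (derivative p) * jx k + (w * jx k - jx k * w) := by
  obtain ⟨A, hA⟩ := (Jordan.polyEquiv k).surjective (D (jy k))
  rw [Jordan.polyEquiv_apply] at hA
  obtain ⟨W, hW⟩ := Jordan.exists_derivative_eq k A.divX.divX
  have hyx := Jordan.jy_mul_jx k
  have hD' := congrArg D hyx
  rw [map_add, hD, hD, hD] at hD'
  have hA' : A = C (A.coeff 0) + X * C (A.divX.coeff 0) + X ^ 2 * derivative W := by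
    rw [hW]
    linear_combination -X_mul_divX_add A - X * X_mul_divX_add A.divX
  generalize A.coeff 0 = p at hA'
  generalize A.divX.coeff 0 = a at hA'
  set u := Jordan.ofPoly k W with hu
  have hDy : D (jy k) = aeval (jy k) p + Jordan.ofPoly k (X * C a) + (jy k * u - u * jy k) := by
    rw [← hA, hA', hu, Jordan.jy_mul_ofPoly, Jordan.ofPoly_mul_jy, ← map_sub,
      Jordan.yOp_apply, add_sub_cancel_left, map_add, map_add, Jordan.ofPoly_C]
  obtain ⟨B, hB⟩ := (Jordan.polyEquiv k).surjective
    (D (jx k) - aeval (jy k) (derivative p) * jx k - (jx k * u - u * jx k))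
  rw [Jordan.polyEquiv_apply] at hB
  have hDx := eq_add_of_sub_eq (eq_add_of_sub_eq hB.symm)
  have hp := Jordan.aeval_mul_jx k p
  have hpy := (Jordan.commute_jy_aeval k (derivative p)).eq
  have hrel : Jordan.ofPoly k (X * C a) * jx k + jy k * Jordan.ofPoly k B =
      Jordan.ofPoly k B * jy k + jx k * Jordan.ofPoly k (X * C a) +
        (Jordan.ofPoly k B * jx k + jx k * Jordan.ofPoly k B) := by
    rw [hDy, hDx] at hD'
    linear_combination (norm := noncomm_ring) hD' - hp - hpy * jx k
      - aeval (jy k) (derivative p) * hyx - hyx * u + u * hyx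
  have hrel' := Jordan.relation_normalForm k hrel
  obtain ⟨α, rfl⟩ : ∃ α, a = C α := ⟨_, eq_C_of_natDegree_eq_zero
    (derivative_eq_zero.mp (Jordan.derivative_eq_zero_of_relation k hrel'))⟩
  obtain ⟨Q, hQ⟩ := Jordan.exists_derivative_eq k (B.coeff 2)
  have hB' : B - X * Jordan.rightX k (C (derivative Q)) = 0 := by
    apply Jordan.eq_zero_of_homogeneous
    · have hqx := Jordan.aeval_mul_jx k Q
      have hb : Jordan.ofPoly k (B - X * Jordan.rightX k (C (derivative Q))) =
          Jordan.ofPoly k B - (aeval (jy k) Q * jx k - jx k * aeval (jy k) Q) := by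
        rw [map_sub, Jordan.ofPoly_X_mul, Jordan.ofPoly_rightX, Jordan.ofPoly_C, hqx,
          add_sub_cancel_left, mul_assoc]
      have hx : Jordan.ofPoly k (X * C (C α)) * jx k = jx k * Jordan.ofPoly k (X * C (C α)) := by
        rw [Jordan.ofPoly_X_mul, Jordan.ofPoly_C, aeval_C, mul_assoc, Algebra.commutes]
      have hq := (Jordan.commute_jy_aeval k Q).eq
      have h := Jordan.relation_normalForm k (A := 0)
        (B := B - X * Jordan.rightX k (C (derivative Q))) (by
          rw [hb, map_zero]
          linear_combination (norm := noncomm_ring) hrel - hx - aeval (jy k) Q * hyx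
            + hyx * aeval (jy k) Q - hq * jx k + jx k * hq)
      simpa only [map_zero, mul_zero, zero_add] using h
    · rw [coeff_sub, coeff_X_mul, Jordan.coeff_rightX_one, coeff_C_zero, hQ, sub_self]
  refine ⟨α, p, aeval (jy k) Q - u, ?_, ?_⟩
  · have := (Jordan.commute_jy_aeval k Q).eq
    rw [hDy, Jordan.ofPoly_X_mul, Jordan.ofPoly_C, aeval_C, ← Algebra.commutes,
      ← Algebra.smul_def, sub_mul, mul_sub, this]
    abel
  · rw [hDx, sub_eq_zero.mp hB', Jordan.ofPoly_X_mul, Jordan.ofPoly_rightX, Jordan.ofPoly_C,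
      sub_mul, mul_sub, Jordan.aeval_mul_jx k Q]
    noncomm_ring

end
end

section
/- Let k be a field of characteristic 0 and let J = k⟨x,y⟩/(yx − xy − x²) be the Jordan plane over k. Then the subset { x a − a x + x b + b x − y b + b y : a, b ∈ J } of J is equal to the two-sided ideal of J generated by x. -/
open TensorProduct LinearMap

noncomputable section

variable (k : Type*) [Field k]

section Abstract

variable {A : Type*} [Ring A] [Algebra k A] {x y : A}

/-- The span of the ordered monomials `xᵐ yˡ` with `d ≤ m` and `l < n`. -/
def monomialSpan (x y : A) (d n : ℕ) : Submodule k A :=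
  Submodule.span k {z | ∃ m l, d ≤ m ∧ l < n ∧ z = x ^ m * y ^ l}

variable {k} in
theorem pow_mul_pow_mem_monomialSpan {d n m l : ℕ} (hm : d ≤ m) (hl : l < n) :
    x ^ m * y ^ l ∈ monomialSpan k x y d n :=
  Submodule.subset_span ⟨m, l, hm, hl, rfl⟩

/-- A left multiplication maps `monomialSpan` into `V` as soon as it does so on monomials. -/
theorem mul_mem_of_mem_monomialSpan {d n : ℕ} {V : Submodule k A} (a : A)
    (h : ∀ m l, d ≤ m → l < n → a * (x ^ m * y ^ l) ∈ V) {z : A}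
    (hz : z ∈ monomialSpan k x y d n) : a * z ∈ V := by
  have hle : monomialSpan k x y d n ≤ V.comap (LinearMap.mulLeft k a) :=
    Submodule.span_le.2 fun _ ⟨m, l, hm, hl, he⟩ => he ▸ h m l hm hl
  exact hle hz

theorem y_mul_pow (hxy : y * x = x * y + x * x) (m : ℕ) :
    y * x ^ m = x ^ m * y + m • x ^ (m + 1) := by
  induction m with
  | zero => simp
  | succ m ih =>
    rw [pow_succ, ← mul_assoc, ih, add_mul, mul_assoc, hxy, smul_mul_assoc, ← pow_succ]
    simp only [mul_add, succ_nsmul, pow_succ, mul_assoc]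
    abel

theorem y_mul_pow_mul_pow (hxy : y * x = x * y + x * x) (m l : ℕ) :
    y * (x ^ m * y ^ l) = x ^ m * y ^ (l + 1) + m • (x ^ (m + 1) * y ^ l) := by
  rw [← mul_assoc, y_mul_pow hxy, add_mul, mul_assoc, ← pow_succ', smul_mul_assoc]

/-- The two leading terms of `yⁿ⁺¹ x` in terms of ordered monomials. -/
theorem y_pow_succ_mul_sub_mem (hxy : y * x = x * y + x * x) (n : ℕ) :
    y ^ (n + 1) * x - x * y ^ (n + 1) - (n + 1) • (x ^ 2 * y ^ n) ∈
      monomialSpan k x y 3 n := by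
  induction n with
  | zero => simp [hxy, pow_two]
  | succ n ih =>
    have hmul := mul_mem_of_mem_monomialSpan k (V := monomialSpan k x y 3 (n + 1)) y
      (fun m l hm hl => by
        rw [y_mul_pow_mul_pow hxy]
        exact add_mem (pow_mul_pow_mem_monomialSpan hm (by omega))
          (nsmul_mem (pow_mul_pow_mem_monomialSpan (by omega) (by omega)) _)) ih
    have h3 : x ^ 3 * y ^ n ∈ monomialSpan k x y 3 (n + 1) :=
      pow_mul_pow_mem_monomialSpan le_rfl (by omega)
    convert add_mem hmul (nsmul_mem h3 ((n + 1) * 2)) using 1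
    have h1 := y_mul_pow_mul_pow hxy 1 (n + 1)
    have h2 := y_mul_pow_mul_pow hxy 2 n
    rw [pow_one, one_smul] at h1
    rw [mul_sub, mul_sub, mul_smul_comm, h1, h2, ← mul_assoc, ← pow_succ', smul_add, smul_smul,
      succ_nsmul _ (n + 1)]
    abel

theorem y_pow_mul_sub_mem (hxy : y * x = x * y + x * x) (n : ℕ) :
    y ^ n * x - x * y ^ n ∈ monomialSpan k x y 2 n := by
  cases n with
  | zero => simp
  | succ n =>
    have hle : monomialSpan k x y 3 n ≤ monomialSpan k x y 2 (n + 1) :=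
      Submodule.span_mono fun _ ⟨m, l, hm, hl, he⟩ => ⟨m, l, by omega, by omega, he⟩
    have h2 : x ^ 2 * y ^ n ∈ monomialSpan k x y 2 (n + 1) :=
      pow_mul_pow_mem_monomialSpan le_rfl (by omega)
    simpa using add_mem (hle (y_pow_succ_mul_sub_mem k hxy n)) (nsmul_mem h2 (n + 1))

/-- The linear map `(a, b) ↦ xa − ax + xb + bx − yb + by`. -/
def boundary (x y : A) : A × A →ₗ[k] A :=
  (LinearMap.mulLeft k x - LinearMap.mulRight k x) ∘ₗ LinearMap.fst k A A +
    (LinearMap.mulLeft k x + LinearMap.mulRight k x - LinearMap.mulLeft k y +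
      LinearMap.mulRight k y) ∘ₗ LinearMap.snd k A A

theorem boundary_apply (a b : A) :
    boundary k x y (a, b) = x * a - a * x + x * b + b * x - y * b + b * y := by
  simp only [boundary, LinearMap.add_apply, LinearMap.comp_apply, LinearMap.sub_apply,
    LinearMap.fst_apply, LinearMap.snd_apply, LinearMap.mulLeft_apply, LinearMap.mulRight_apply]
  abel

theorem pow_mul_pow_mem_range_boundary [CharZero k] (hxy : y * x = x * y + x * x) (n : ℕ) :
    ∀ m, 1 ≤ m → x ^ m * y ^ n ∈ LinearMap.range (boundary k x y) := by
  induction n using Nat.strong_induction_on with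
  | _ n ih =>
    have cancel {c : ℕ} {z : A} (hc : c ≠ 0) (hz : c • z ∈ LinearMap.range (boundary k x y)) :
        z ∈ LinearMap.range (boundary k x y) := by
      rw [← Nat.cast_smul_eq_nsmul k] at hz
      exact (Submodule.smul_mem_iff _ (Nat.cast_ne_zero.2 hc)).1 hz
    intro m hm
    obtain rfl | hm := hm.eq_or_lt
    · refine cancel two_ne_zero ?_
      have hb := LinearMap.mem_range_self (boundary k x y) (0, y ^ n)
      have hr := mul_mem_of_mem_monomialSpan k (V := LinearMap.range (boundary k x y)) 1
        (fun m l hm hl => by rw [one_mul]; exact ih l hl m (by omega)) (y_pow_mul_sub_mem k hxy n)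
      convert sub_mem hb hr using 1
      rw [boundary_apply, (Commute.self_pow y n).eq, two_nsmul, pow_one, one_mul]
      simp only [mul_zero, zero_mul]
      abel
    · obtain ⟨m, rfl⟩ := Nat.exists_eq_add_of_le' hm
      refine cancel n.succ_ne_zero ?_
      have ha := LinearMap.mem_range_self (boundary k x y) (x ^ m * y ^ (n + 1), 0)
      have hr := mul_mem_of_mem_monomialSpan k (V := LinearMap.range (boundary k x y)) (x ^ m)
        (fun i l hi hl => by
          rw [← mul_assoc, ← pow_add]; exact ih l hl _ (by omega))
        (y_pow_succ_mul_sub_mem k hxy n)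
      convert neg_mem (add_mem ha hr) using 1
      have hx : x * (x ^ m * y ^ (n + 1)) = x ^ m * (x * y ^ (n + 1)) := by
        rw [← mul_assoc, ← mul_assoc, (Commute.self_pow x m).eq]
      rw [boundary_apply, hx, mul_sub, mul_sub, mul_smul_comm, ← mul_assoc _ (x ^ 2), ← pow_add,
        mul_assoc _ _ x]
      simp only [mul_zero, zero_mul, Nat.succ_eq_add_one]
      abel

/-- The span of the ordered monomials divisible by `x`. -/
def xMonomialSpan (x y : A) : Submodule k A :=
  Submodule.span k {z | ∃ m l, 1 ≤ m ∧ z = x ^ m * y ^ l}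

theorem mul_mem_xMonomialSpan (hxy : y * x = x * y + x * x)
    (hgen : Algebra.adjoin k {x, y} = ⊤) (a : A) :
    ∀ z ∈ xMonomialSpan k x y, a * z ∈ xMonomialSpan k x y := by
  have mono {m l : ℕ} (hm : 1 ≤ m) : x ^ m * y ^ l ∈ xMonomialSpan k x y :=
    Submodule.subset_span ⟨m, l, hm, rfl⟩
  have of_mono (a : A) (h : ∀ m l, 1 ≤ m → a * (x ^ m * y ^ l) ∈ xMonomialSpan k x y) :
      ∀ z ∈ xMonomialSpan k x y, a * z ∈ xMonomialSpan k x y := by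
    have hle : xMonomialSpan k x y ≤ (xMonomialSpan k x y).comap (LinearMap.mulLeft k a) :=
      Submodule.span_le.2 fun _ ⟨m, l, hm, he⟩ => he ▸ h m l hm
    exact fun z hz => hle hz
  have ha : a ∈ Algebra.adjoin k {x, y} := hgen ▸ Algebra.mem_top
  induction ha using Algebra.adjoin_induction with
  | mem a ha =>
    obtain rfl | rfl := ha
    · exact of_mono _ fun m l hm => by
        rw [← mul_assoc, ← pow_succ']; exact mono (by omega)
    · exact of_mono _ fun m l hm => by
        rw [y_mul_pow_mul_pow hxy]
        exact add_mem (mono hm) (nsmul_mem (mono (by omega)) _)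
  | algebraMap r =>
    exact fun z hz => by rw [← Algebra.smul_def]; exact Submodule.smul_mem _ r hz
  | add a b _ _ iha ihb => exact fun z hz => by rw [add_mul]; exact add_mem (iha z hz) (ihb z hz)
  | mul a b _ _ iha ihb => exact fun z hz => by rw [mul_assoc]; exact iha _ (ihb z hz)

theorem xMonomialSpan_mul_mem (hxy : y * x = x * y + x * x)
    (hgen : Algebra.adjoin k {x, y} = ⊤) (a : A) :
    ∀ z ∈ xMonomialSpan k x y, z * a ∈ xMonomialSpan k x y := by
  have mono {m l : ℕ} (hm : 1 ≤ m) : x ^ m * y ^ l ∈ xMonomialSpan k x y :=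
    Submodule.subset_span ⟨m, l, hm, rfl⟩
  have of_mono (a : A) (h : ∀ m l, 1 ≤ m → x ^ m * y ^ l * a ∈ xMonomialSpan k x y) :
      ∀ z ∈ xMonomialSpan k x y, z * a ∈ xMonomialSpan k x y := by
    have hle : xMonomialSpan k x y ≤ (xMonomialSpan k x y).comap (LinearMap.mulRight k a) :=
      Submodule.span_le.2 fun _ ⟨m, l, hm, he⟩ => he ▸ h m l hm
    exact fun z hz => hle hz
  have ha : a ∈ Algebra.adjoin k {x, y} := hgen ▸ Algebra.mem_top
  induction ha using Algebra.adjoin_induction with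
  | mem a ha =>
    obtain rfl | rfl := ha
    · refine of_mono _ fun m l hm => ?_
      have hr := mul_mem_of_mem_monomialSpan k (V := xMonomialSpan k a y) (a ^ m)
        (fun i l hi hl => by rw [← mul_assoc, ← pow_add]; exact mono (by omega))
        (y_pow_mul_sub_mem k hxy l)
      have hm1 : a ^ (m + 1) * y ^ l ∈ xMonomialSpan k a y := mono (by omega)
      convert add_mem hr hm1 using 1
      rw [mul_sub, pow_succ, mul_assoc, mul_assoc, sub_add_cancel]
    · exact of_mono _ fun m l hm => by
        rw [mul_assoc, ← pow_succ]; exact mono hm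
  | algebraMap r =>
    exact fun z hz => by
      rw [← Algebra.commutes, ← Algebra.smul_def]; exact Submodule.smul_mem _ r hz
  | add a b _ _ iha ihb => exact fun z hz => by rw [mul_add]; exact add_mem (iha z hz) (ihb z hz)
  | mul a b _ _ iha ihb => exact fun z hz => by rw [← mul_assoc]; exact ihb _ (iha z hz)

theorem mem_xMonomialSpan_of_mem_span (hxy : y * x = x * y + x * x)
    (hgen : Algebra.adjoin k {x, y} = ⊤) {z : A} (hz : z ∈ TwoSidedIdeal.span {x}) :
    z ∈ xMonomialSpan k x y := by
  let I : TwoSidedIdeal A := TwoSidedIdeal.mk' (xMonomialSpan k x y) (zero_mem _) add_mem neg_mem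
    (fun {a z} hz => mul_mem_xMonomialSpan k hxy hgen a z hz)
    (fun {z a} hz => xMonomialSpan_mul_mem k hxy hgen a z hz)
  have hx : x ∈ xMonomialSpan k x y := Submodule.subset_span ⟨1, 0, le_rfl, by simp⟩
  have hI : z ∈ I := TwoSidedIdeal.span_le.2
    (Set.singleton_subset_iff.2 <| (TwoSidedIdeal.mem_mk' _ _ _ _ _ _ _).2 hx) hz
  exact (TwoSidedIdeal.mem_mk' _ _ _ _ _ _ _).1 hI

theorem mul_sub_mul_mem_span (hgen : Algebra.adjoin k {x, y} = ⊤) (b : A) :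
    y * b - b * y ∈ TwoSidedIdeal.span {x} := by
  have hx : x ∈ TwoSidedIdeal.span {x} := TwoSidedIdeal.subset_span rfl
  have hb : b ∈ Algebra.adjoin k {x, y} := hgen ▸ Algebra.mem_top
  induction hb using Algebra.adjoin_induction with
  | mem b hb =>
    obtain rfl | rfl := hb
    · exact sub_mem (TwoSidedIdeal.mul_mem_left _ _ _ hx) (TwoSidedIdeal.mul_mem_right _ _ _ hx)
    · rw [sub_self]; exact zero_mem _
  | algebraMap r => rw [Algebra.commutes, sub_self]; exact zero_mem _
  | add a b _ _ iha ihb =>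
    convert add_mem iha ihb using 1
    noncomm_ring
  | mul a b _ _ iha ihb =>
    convert add_mem (TwoSidedIdeal.mul_mem_right _ _ b iha)
      (TwoSidedIdeal.mul_mem_left _ a _ ihb) using 1
    noncomm_ring

theorem setOf_boundary_eq_span [CharZero k] (hxy : y * x = x * y + x * x)
    (hgen : Algebra.adjoin k {x, y} = ⊤) :
    {z : A | ∃ a b : A, z = x * a - a * x + x * b + b * x - y * b + b * y} =
      (TwoSidedIdeal.span {x} : TwoSidedIdeal A) := by
  ext z
  constructor
  · rintro ⟨a, b, rfl⟩
    have hx : x ∈ TwoSidedIdeal.span {x} := TwoSidedIdeal.subset_span rfl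
    have hl (c : A) : c * x ∈ TwoSidedIdeal.span {x} := TwoSidedIdeal.mul_mem_left _ _ _ hx
    have hr (c : A) : x * c ∈ TwoSidedIdeal.span {x} := TwoSidedIdeal.mul_mem_right _ _ _ hx
    rw [sub_add]
    exact sub_mem (add_mem (add_mem (sub_mem (hr a) (hl a)) (hr b)) (hl b))
      (mul_sub_mul_mem_span k hgen b)
  · intro hz
    have hle : xMonomialSpan k x y ≤ LinearMap.range (boundary k x y) :=
      Submodule.span_le.2 fun _ ⟨m, l, hm, he⟩ =>
        he ▸ pow_mul_pow_mem_range_boundary k hxy l m hm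
    obtain ⟨⟨a, b⟩, rfl⟩ := hle (mem_xMonomialSpan_of_mem_span k hxy hgen hz)
    exact ⟨a, b, boundary_apply k a b⟩

end Abstract

/-- The quotient map from the free algebra onto the Jordan plane. -/
def jordanMk : FreeAlgebra k (Fin 2) →ₐ[k] Jordan k := RingQuot.mkAlgHom k (jordanRel k)

theorem jordanMk_surjective : Function.Surjective (jordanMk k) :=
  RingQuot.mkAlgHom_surjective k (jordanRel k)

theorem adjoin_jx_jy : Algebra.adjoin k {jx k, jy k} = ⊤ := by
  have himage : jordanMk k '' Set.range (FreeAlgebra.ι k) = {jx k, jy k} := by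
    ext z
    simp only [← Set.range_comp, Set.mem_range, Fin.exists_fin_two, Set.mem_insert_iff,
      Set.mem_singleton_iff, eq_comm (a := z)]
    rfl
  rw [← himage, ← AlgHom.map_adjoin, FreeAlgebra.adjoin_range_ι, Algebra.map_top,
    AlgHom.range_eq_top]
  exact jordanMk_surjective k

/-- In characteristic `0`, the set
`{ xa − ax + xb + bx − yb + by : a, b ∈ J }` equals the two-sided ideal of the
Jordan plane generated by `x`. -/
theorem jordan_image_d2 [CharZero k] :
    {z : Jordan k | ∃ a b : Jordan k,
        z = jx k * a - a * jx k + jx k * b + b * jx k - jy k * b + b * jy k} =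
      (TwoSidedIdeal.span {jx k} : TwoSidedIdeal (Jordan k)) := by
  exact setOf_boundary_eq_span k (jy_mul_jx k) (adjoin_jx_jy k)

end
end
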